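/- arXiv:1906.01289 — 3 statements merged into one kernel-verified Lean document; each statement's English description precedes it below -/
import Mathlib

section
/- Let d ≥ 1, m > 1, m* = m/(m−1), and suppose (b,V) satisfies hypothesis (H1) with parameters δ = 0, ρ > 0, a ∈ ℝ, η > 0, R > 0, with η > 1 and a < d − 1. Then lim_{β→∞} β^{1/(η−1)} (ρ^{m*}/m* − λ_max(β)) = c₁, where c₁ := (η−1) · (ρ^{m*−1}(d−1−a)/η)^{η/(η−1)}. -/
open Filter Real RealInnerProductSpace

noncomputable section

abbrev Euc (d : ℕ) := EuclideanSpace ℝ (Fin d)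

/-- The Laplacian of `φ`, defined as the sum of the second partial derivatives
in the coordinate directions. -/
def lap {d : ℕ} (φ : Euc d → ℝ) (x : Euc d) : ℝ :=
  ∑ i : Fin d, fderiv ℝ (fun y => fderiv ℝ φ y (EuclideanSpace.single i 1)) x
    (EuclideanSpace.single i 1)

/-- `(lam, φ)` is a subsolution of the ergodic problem (EP). -/
def IsSubsol {d : ℕ} (m : ℝ) (b : Euc d → Euc d) (V : Euc d → ℝ) (β lam : ℝ)
    (φ : Euc d → ℝ) : Prop :=
  ContDiff ℝ 3 φ ∧ ∀ x : Euc d,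
    lam - lap φ x + ⟪b x, gradient φ x⟫ + (1 / m) * ‖gradient φ x‖ ^ m - β * V x ≤ 0

/-- The generalized principal eigenvalue `λ_max(β)`. -/
def lamMax {d : ℕ} (m : ℝ) (b : Euc d → Euc d) (V : Euc d → ℝ) (β : ℝ) : ℝ :=
  sSup {lam : ℝ | ∃ φ : Euc d → ℝ, IsSubsol m b V β lam φ}

/-- Hypothesis (H0) with parameter `δ` and constants `ρ, R` and auxiliary function `α`. -/
def HypH0 {d : ℕ} (δ ρ R : ℝ) (b : Euc d → Euc d) (V : Euc d → ℝ) (α : Euc d → ℝ) : Prop :=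
  ContDiff ℝ 2 b ∧ ContDiff ℝ 2 V ∧ (∃ M : ℝ, ∀ x : Euc d, ‖gradient V x‖ ≤ M) ∧
  ContDiff ℝ 2 α ∧
  (∀ x : Euc d, R ≤ ‖x‖ → b x = ((ρ + α x) * ‖x‖ ^ (δ - 1)) • x) ∧
  Tendsto α (cocompact (Euc d)) (nhds 0) ∧
  (∀ x : Euc d, 0 ≤ V x) ∧
  Metric.closedBall (0 : Euc d) R ⊆ interior (Function.support V) ∧
  Tendsto V (cocompact (Euc d)) (nhds 0)

/-- Hypothesis (H1): (H0) together with `α(x) = a|x|⁻¹` and `V(x) = |x|^{-η}` outside `B_R`. -/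
def HypH1 {d : ℕ} (δ ρ R a η : ℝ) (b : Euc d → Euc d) (V : Euc d → ℝ) (α : Euc d → ℝ) : Prop :=
  HypH0 δ ρ R b V α ∧
  ∀ x : Euc d, R ≤ ‖x‖ → α x = a * ‖x‖⁻¹ ∧ V x = ‖x‖ ^ (-η)

lemma hasFDerivAt_norm_aux {d : ℕ} {x : Euc d} (hx : x ≠ 0) :
    HasFDerivAt (fun y : Euc d => ‖y‖) (‖x‖⁻¹ • innerSL ℝ x) x := by
  have h := ((hasStrictFDerivAt_norm_sq x).hasFDerivAt).sqrt (by simpa using hx)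
  have h2 : (fun y : Euc d => √(‖y‖ ^ 2)) = fun y => ‖y‖ := by
    funext y; exact Real.sqrt_sq (norm_nonneg y)
  rw [h2] at h
  refine h.congr_fderiv ?_
  rw [Real.sqrt_sq (norm_nonneg x)]
  ext v
  simp
  ring

lemma gradient_inner_aux {d : ℕ} (f : Euc d → ℝ) (x v : Euc d) :
    fderiv ℝ f x v = ⟪gradient f x, v⟫ := by
  simp [gradient]

lemma sum_coord_fderiv {d : ℕ} (f : Euc d → ℝ) (x v : Euc d) :
    fderiv ℝ f x v = ∑ i : Fin d, v i * fderiv ℝ f x (EuclideanSpace.single i 1) := by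
  conv_lhs => rw [← (EuclideanSpace.basisFun (Fin d) ℝ).sum_repr v]
  simp

lemma sum_fderiv_mul {d : ℕ} (f g : Euc d → ℝ) (x : Euc d) :
    ∑ i : Fin d, fderiv ℝ f x (EuclideanSpace.single i 1) *
      fderiv ℝ g x (EuclideanSpace.single i 1) = fderiv ℝ f x (gradient g x) := by
  rw [sum_coord_fderiv f x (gradient g x)]
  refine Finset.sum_congr rfl fun i _ => ?_
  rw [gradient_inner_aux g x, EuclideanSpace.inner_single_right]
  simp [mul_comm]

lemma lap_neg_norm {d : ℕ} (p : ℝ) {x : Euc d} (hx : x ≠ 0) :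
    lap (fun y : Euc d => -p * ‖y‖) x = -p * (((d : ℝ) - 1) / ‖x‖) := by
  have hn : ‖x‖ ≠ 0 := by simpa using hx
  have key : ∀ i : Fin d, fderiv ℝ (fun y => fderiv ℝ (fun y : Euc d => -p * ‖y‖) y
      (EuclideanSpace.single i 1)) x (EuclideanSpace.single i 1)
      = -p * (‖x‖⁻¹ - ‖x‖⁻¹ ^ 3 * x i ^ 2) := by
    intro i
    have h1 : (fun y => fderiv ℝ (fun y : Euc d => -p * ‖y‖) y
      (EuclideanSpace.single i 1)) =ᶠ[nhds x] fun y => -p * (‖y‖⁻¹ * y i) := by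
      filter_upwards [isOpen_ne.mem_nhds hx] with y hy
      rw [((hasFDerivAt_norm_aux hy).const_mul (-p)).fderiv]
      simp [EuclideanSpace.inner_single_right]
    rw [h1.fderiv_eq]
    have h2 : HasFDerivAt (fun y : Euc d => y i) (EuclideanSpace.proj i : Euc d →L[ℝ] ℝ) x :=
      (EuclideanSpace.proj i : Euc d →L[ℝ] ℝ).hasFDerivAt
    have h3 := (((hasDerivAt_inv hn).comp_hasFDerivAt x (hasFDerivAt_norm_aux hx)).mul h2).const_mul (-p)
    have h4 : fderiv ℝ (fun y : Euc d => -p * (‖y‖⁻¹ * y i)) x = _ := h3.fderiv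
    rw [h4]
    simp [EuclideanSpace.inner_single_right]
    field_simp
    ring
  unfold lap
  rw [Finset.sum_congr rfl fun i _ => key i, ← Finset.mul_sum, Finset.sum_sub_distrib,
    ← Finset.mul_sum, ← EuclideanSpace.real_norm_sq_eq]
  simp
  left
  field_simp

lemma gradient_neg_norm {d : ℕ} (p : ℝ) {x : Euc d} (hx : x ≠ 0) :
    gradient (fun y : Euc d => -p * ‖y‖) x = (-p * ‖x‖⁻¹) • x := by
  have h : ∀ v, ⟪gradient (fun y : Euc d => -p * ‖y‖) x, v⟫ = ⟪(-p * ‖x‖⁻¹) • x, v⟫ := by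
    intro v
    rw [← gradient_inner_aux, ((hasFDerivAt_norm_aux hx).const_mul (-p)).fderiv]
    simp [inner_smul_left]
    ring
  exact ext_inner_right ℝ h

lemma lap_congr {d : ℕ} {f g : Euc d → ℝ} {x : Euc d} (h : f =ᶠ[nhds x] g) :
    lap f x = lap g x := by
  unfold lap
  refine Finset.sum_congr rfl fun i _ => ?_
  have : (fun y => fderiv ℝ f y (EuclideanSpace.single i 1)) =ᶠ[nhds x]
      fun y => fderiv ℝ g y (EuclideanSpace.single i 1) := by
    filter_upwards [h.fderiv (𝕜 := ℝ)] with y hy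
    rw [hy]
  rw [this.fderiv_eq]

lemma gradient_congr {d : ℕ} {f g : Euc d → ℝ} {x : Euc d} (h : f =ᶠ[nhds x] g) :
    gradient f x = gradient g x := by
  unfold gradient
  rw [h.fderiv_eq]

lemma continuous_gradient_aux {d : ℕ} {f : Euc d → ℝ} (h : ContDiff ℝ 3 f) :
    Continuous (gradient f) := by
  unfold gradient
  exact (LinearIsometryEquiv.continuous _).comp (h.continuous_fderiv (by norm_num))

lemma contDiff_partial {d : ℕ} {f : Euc d → ℝ} (h : ContDiff ℝ 3 f) (v : Euc d) :
    ContDiff ℝ 1 (fun y => fderiv ℝ f y v) := by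
  exact (h.fderiv_right (m := 1) (by norm_num)).clm_apply contDiff_const

lemma continuous_partial2 {d : ℕ} {f : Euc d → ℝ} (h : ContDiff ℝ 3 f) (v : Euc d) :
    Continuous (fun x => fderiv ℝ (fun y => fderiv ℝ f y v) x v) := 
  ((contDiff_partial h v).continuous_fderiv (by norm_num)).clm_apply continuous_const

lemma continuous_lap {d : ℕ} {f : Euc d → ℝ} (h : ContDiff ℝ 3 f) :
    Continuous (lap f) := by
  unfold lap
  exact continuous_finsetSum _ fun i _ => continuous_partial2 h _


/-- radial weight function -/
def radW (n : ℕ) (f : ℝ → ℝ) (x : Euc (n + 1)) : ℝ := f ‖x‖ * (‖x‖ ^ n)⁻¹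

lemma radW_zero_nhds {n : ℕ} {f : ℝ → ℝ} {R : ℝ} (hf : ∀ r ≤ R, f r = 0)
    {x : Euc (n + 1)} (hx : ‖x‖ < R) : radW n f =ᶠ[nhds x] fun _ => 0 := by
  have : {y : Euc (n + 1) | ‖y‖ < R} ∈ nhds x :=
    (isOpen_lt continuous_norm continuous_const).mem_nhds hx
  filter_upwards [this] with y hy
  simp [radW, hf ‖y‖ (le_of_lt hy)]

lemma radW_continuous {n : ℕ} {f : ℝ → ℝ} {R : ℝ} (hR : 0 < R) (hf : ∀ r ≤ R, f r = 0)
    (hc : Continuous f) : Continuous (radW n f) := by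
  rw [continuous_iff_continuousAt]
  intro x
  by_cases hx : x = 0
  · exact (continuousAt_const.congr (radW_zero_nhds hf (by simpa [hx] using hR)).symm)
  · have hn : ‖x‖ ^ n ≠ 0 := by simp [hx]
    unfold radW
    exact (hc.continuousAt.comp continuous_norm.continuousAt).mul
      ((continuous_norm.continuousAt.pow n).inv₀ hn)

lemma radW_contDiff {n : ℕ} {f : ℝ → ℝ} {R : ℝ} (hR : 0 < R) (hf : ∀ r ≤ R, f r = 0)
    (hc : ContDiff ℝ 1 f) : ContDiff ℝ 1 (radW n f) := by
  rw [contDiff_iff_contDiffAt]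
  intro x
  by_cases hx : x = 0
  · exact contDiffAt_const.congr_of_eventuallyEq (radW_zero_nhds hf (by simpa [hx] using hR))
  · have hn : ‖x‖ ^ n ≠ 0 := by simp [hx]
    unfold radW
    exact (hc.contDiffAt.comp x (contDiffAt_norm ℝ hx)).mul
      (((contDiffAt_norm ℝ hx).pow n).inv hn)

lemma radW_compact {n : ℕ} {f : ℝ → ℝ} (hc : HasCompactSupport f) :
    HasCompactSupport (radW n f) := by
  obtain ⟨M, hM⟩ := hc.isCompact.isBounded.exists_norm_le
  refine HasCompactSupport.intro (isCompact_closedBall (0 : Euc (n + 1)) M) ?_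
  intro x hx
  have : f ‖x‖ = 0 := by
    by_contra h
    have := hM ‖x‖ (subset_tsupport f h)
    simp at hx this
    linarith
  simp [radW, this]

lemma radW_integral (n : ℕ) : ∃ c : ℝ, 0 < c ∧ ∀ (f : ℝ → ℝ) (R : ℝ), 0 < R →
    (∀ r ≤ R, f r = 0) → ∫ x, radW n f x = c * ∫ r, f r := by
  refine ⟨(n + 1) * (MeasureTheory.volume.real (Metric.ball (0 : Euc (n + 1)) 1)), ?_, ?_⟩
  · have : 0 < MeasureTheory.volume.real (Metric.ball (0 : Euc (n + 1)) 1) := by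
      rw [MeasureTheory.Measure.real, ENNReal.toReal_pos_iff]
      exact ⟨Metric.measure_ball_pos _ _ one_pos, MeasureTheory.measure_ball_lt_top⟩
    positivity
  · intro f R hR hf
    have h := MeasureTheory.integral_fun_norm_addHaar
      (MeasureTheory.volume : MeasureTheory.Measure (Euc (n + 1))) (fun r => f r * (r ^ n)⁻¹)
    have e : ∫ y in Set.Ioi (0 : ℝ), y ^ (Module.finrank ℝ (Euc (n + 1)) - 1) •
        (f y * (y ^ n)⁻¹) = ∫ r, f r := by
      have h0 : ∫ r in Set.Ioi (0 : ℝ), f r = ∫ r, f r := by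
        refine MeasureTheory.setIntegral_eq_integral_of_forall_compl_eq_zero fun x hx => ?_
        have hx' : x ≤ 0 := not_lt.1 hx
        exact hf x (by linarith)
      rw [← h0]
      refine MeasureTheory.setIntegral_congr_fun measurableSet_Ioi fun y hy => ?_
      have hy' : (0 : ℝ) < y := hy
      simp
      field_simp
    rw [e] at h
    unfold radW
    rw [h]
    simp
    ring

lemma radG_deriv (n : ℕ) {g : ℝ → ℝ} {r : ℝ} (hr : 0 < r) (hg : DifferentiableAt ℝ g r) :
    HasDerivAt (fun r => g r * (r ^ n)⁻¹)
      ((deriv g r - n / r * g r) * (r ^ n)⁻¹) r := by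
  have h1 : HasDerivAt (fun r : ℝ => (r ^ n)⁻¹) (-(n / r) * (r ^ n)⁻¹) r := by
    refine ((hasDerivAt_pow n r).inv (by positivity)).congr_deriv ?_
    cases n with
    | zero => simp
    | succ k =>
      simp
      field_simp
      ring
  exact (hg.hasDerivAt.mul h1).congr_deriv (by ring)

lemma radW_fderiv (n : ℕ) {g : ℝ → ℝ} {x : Euc (n + 1)} (hx : x ≠ 0)
    (hg : DifferentiableAt ℝ g ‖x‖) (v : Euc (n + 1)) :
    fderiv ℝ (radW n g) x v =
      ((deriv g ‖x‖ - n / ‖x‖ * g ‖x‖) * (‖x‖ ^ n)⁻¹) * (‖x‖⁻¹ * ⟪x, v⟫) := by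
  have h := (radG_deriv n (norm_pos_iff.2 hx) hg).comp_hasFDerivAt x (hasFDerivAt_norm_aux hx)
  have h4 : fderiv ℝ (radW n g) x = _ := h.fderiv
  rw [h4]
  simp

lemma parts_aux {d : ℕ} {q φ : Euc d → ℝ} (hq : ContDiff ℝ 1 q) (hqc : HasCompactSupport q)
    (hφ : ContDiff ℝ 3 φ) :
    MeasureTheory.Integrable (fun x => q x * lap φ x + fderiv ℝ q x (gradient φ x)) ∧
    ∫ x, (q x * lap φ x + fderiv ℝ q x (gradient φ x)) = 0 := by
  have hqi : ∀ i : Fin d, Continuous fun x => fderiv ℝ q x (EuclideanSpace.single i 1) := fun i =>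
    (hq.continuous_fderiv (by norm_num)).clm_apply continuous_const
  have i1 : ∀ i : Fin d, MeasureTheory.Integrable (fun x => q x *
      fderiv ℝ (fun y => fderiv ℝ φ y (EuclideanSpace.single i 1)) x
        (EuclideanSpace.single i 1)) := fun i =>
    (hq.continuous.mul (continuous_partial2 hφ _)).integrable_of_hasCompactSupport hqc.mul_right
  have i2 : ∀ i : Fin d, MeasureTheory.Integrable (fun x =>
      fderiv ℝ q x (EuclideanSpace.single i 1) *
      fderiv ℝ φ x (EuclideanSpace.single i 1)) := fun i =>
    ((hqi i).mul (contDiff_partial hφ _).continuous).integrable_of_hasCompactSupport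
      ((hqc.fderiv_apply ℝ _).mul_right)
  have i3 : ∀ i : Fin d, MeasureTheory.Integrable (fun x => q x *
      fderiv ℝ φ x (EuclideanSpace.single i 1)) := fun i =>
    (hq.continuous.mul (contDiff_partial hφ _).continuous).integrable_of_hasCompactSupport
      hqc.mul_right
  have e : (fun x => q x * lap φ x + fderiv ℝ q x (gradient φ x)) = fun x => ∑ i : Fin d,
      (q x * fderiv ℝ (fun y => fderiv ℝ φ y (EuclideanSpace.single i 1)) x
        (EuclideanSpace.single i 1) + fderiv ℝ q x (EuclideanSpace.single i 1) *
      fderiv ℝ φ x (EuclideanSpace.single i 1)) := by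
    funext x
    rw [Finset.sum_add_distrib, sum_fderiv_mul, lap, Finset.mul_sum]
  rw [e]
  have i4 := fun i : Fin d => (i1 i).add (i2 i)
  simp only [Pi.add_def] at i4
  refine ⟨MeasureTheory.integrable_finsetSum _ fun i _ => i4 i, ?_⟩
  rw [MeasureTheory.integral_finsetSum _ fun i _ => i4 i]
  refine Finset.sum_eq_zero fun i _ => ?_
  rw [MeasureTheory.integral_add (i1 i) (i2 i),
    integral_mul_fderiv_eq_neg_fderiv_mul_of_integrable (i2 i) (i1 i) (i3 i)
      (fun x _ => (hq.differentiable (by norm_num)).differentiableAt)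
      (fun x _ => ((contDiff_partial hφ _).differentiable (by norm_num)).differentiableAt)]
  simp

lemma integral_ineq {n : ℕ} {m ρ R a η β lam : ℝ} (hm : 1 < m) (hR : 0 < R)
    {b : Euc (n + 1) → Euc (n + 1)} {V φ : Euc (n + 1) → ℝ}
    (hb : ∀ x, R ≤ ‖x‖ → b x = ((ρ + a * ‖x‖⁻¹) * ‖x‖⁻¹) • x)
    (hV : ∀ x, R ≤ ‖x‖ → V x = ‖x‖ ^ (-η))
    (hφ : IsSubsol m b V β lam φ) {g P : ℝ → ℝ} (hg : ContDiff ℝ 1 g) (hg0 : ∀ r, 0 ≤ g r)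
    (hgc : HasCompactSupport g) {r1 : ℝ} (hr1 : R < r1) (hgz : ∀ r ≤ r1, g r = 0)
    (hP : Continuous P) (hPc : HasCompactSupport P) (hPz : ∀ r ≤ R, P r = 0)
    (hineq : ∀ r, R < r → ∀ y : ℝ, -(deriv g r + (ρ - (n - a) / r) * g r) * y
      - g r * (|y| ^ m / m) + β * r ^ (-η) * g r ≤ P r) :
    lam * ∫ r, g r ≤ ∫ r, P r := by
  obtain ⟨c, hc, hrad⟩ := radW_integral n
  have hr1' : 0 < r1 := hR.trans hr1
  obtain ⟨j1, j2⟩ := parts_aux (radW_contDiff hr1' hgz hg) (radW_compact (n := n) hgc) hφ.1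
  have k1 : MeasureTheory.Integrable (radW n g) :=
    (radW_continuous hr1' hgz hg.continuous).integrable_of_hasCompactSupport (radW_compact hgc)
  have k2 : MeasureTheory.Integrable (radW n P) :=
    (radW_continuous hR hPz hP).integrable_of_hasCompactSupport (radW_compact hPc)
  have pt : ∀ x, lam * radW n g x ≤ (radW n g x * lap φ x + fderiv ℝ (radW n g) x (gradient φ x))
      + radW n P x := by
    intro x
    by_cases hx : ‖x‖ ≤ R
    · have h1 : fderiv ℝ (radW n g) x = 0 := by
        rw [(radW_zero_nhds hgz (lt_of_le_of_lt hx hr1)).fderiv_eq]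
        simp
      rw [h1]
      simp [radW, hgz ‖x‖ (hx.trans hr1.le), hPz _ hx]
    · push Not at hx
      have hx0 : x ≠ 0 := by
        intro h; simp [h] at hx; linarith
      have hpos : 0 < ‖x‖ := norm_pos_iff.2 hx0
      have hs := hφ.2 x
      rw [hb x hx.le, hV x hx.le, inner_smul_left] at hs
      rw [radW_fderiv n hx0 (hg.differentiable (by norm_num)).differentiableAt]
      set p := gradient φ x
      set r := ‖x‖
      set y : ℝ := r⁻¹ * ⟪x, p⟫ with hy
      have hyp : |y| ≤ ‖p‖ := by
        rw [hy, abs_mul, abs_of_pos (inv_pos.2 hpos), inv_mul_le_iff₀ hpos]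
        exact abs_real_inner_le_norm x p
      have hpow : |y| ^ m ≤ ‖p‖ ^ m := Real.rpow_le_rpow (abs_nonneg _) hyp (by linarith)
      have hi := hineq r hx y
      have hw : 0 < (r ^ n)⁻¹ := by positivity
      have hxy : ⟪x, p⟫ = r * y := by rw [hy]; field_simp
      rw [hxy] at hs
      simp only [conj_trivial] at hs
      have hs' : lam ≤ lap φ x - (ρ + a * r⁻¹) * y - (1 / m) * |y| ^ m + β * r ^ (-η) := by
        have : (1 / m) * |y| ^ m ≤ (1 / m) * ‖p‖ ^ m :=
          mul_le_mul_of_nonneg_left hpow (by positivity)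
        have e : (ρ + a * r⁻¹) * r⁻¹ * (r * y) = (ρ + a * r⁻¹) * y := by field_simp
        rw [e] at hs
        linarith
      have hs2 := mul_le_mul_of_nonneg_left hs' (hg0 r)
      have : lam * g r ≤ g r * lap φ x + (deriv g r - n / r * g r) * y + P r := by
        refine le_trans (le_of_eq (mul_comm _ _)) (hs2.trans ?_)
        have e2 : g r * (lap φ x - (ρ + a * r⁻¹) * y - 1 / m * |y| ^ m + β * r ^ (-η)) =
          g r * lap φ x + (deriv g r - n / r * g r) * y + (-(deriv g r + (ρ - (n - a) / r) * g r) * y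
      - g r * (|y| ^ m / m) + β * r ^ (-η) * g r) := by ring
        rw [e2]
        linarith
      have := mul_le_mul_of_nonneg_right this hw.le
      unfold radW
      change lam * (g r * (r ^ n)⁻¹) ≤ g r * (r ^ n)⁻¹ * lap φ x + (deriv g r - n / r * g r) * (r ^ n)⁻¹ * y + P r * (r ^ n)⁻¹
      linarith
  have hint := MeasureTheory.integral_mono (k1.const_mul lam) (j1.add k2) pt
  rw [MeasureTheory.integral_const_mul] at hint
  have e3 : ∫ x, ((fun x => radW n g x * lap φ x + fderiv ℝ (radW n g) x (gradient φ x)) + radW n P) x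
      = 0 + ∫ x, radW n P x := by
    rw [← j2, ← MeasureTheory.integral_add j1 k2]; rfl
  rw [e3, hrad g r1 hr1' hgz, hrad P R hR hPz, zero_add] at hint
  have : c * (lam * ∫ r, g r) ≤ c * ∫ r, P r := by linarith
  exact le_of_mul_le_mul_left this hc


lemma taylor_aux {s ρ ε : ℝ} (hs : 1 < s) (hρ : 0 < ρ) (hε : 0 < ε) :
    ∃ C : ℝ, 0 ≤ C ∧ ∀ t : ℝ,
      |ρ + t| ^ s / s ≤ ρ ^ s / s + ρ ^ (s - 1) * t + ε * |t| + C * |t| ^ s := by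
  have hd : HasDerivAt (fun z : ℝ => z ^ s) (s * ρ ^ (s - 1)) ρ :=
    Real.hasDerivAt_rpow_const (Or.inl hρ.ne')
  have hs0 : 0 < s := by linarith
  have ho := (hasDerivAt_iff_isLittleO.1 hd).def (c := ε * s) (by positivity)
  obtain ⟨δ0, hδ0, hδ⟩ := Metric.eventually_nhds_iff.1 ho
  obtain ⟨δ, hδp, hδ1, hδ2⟩ : ∃ δ, 0 < δ ∧ δ ≤ δ0 ∧ δ ≤ ρ :=
    ⟨min δ0 ρ, lt_min hδ0 hρ, min_le_left _ _, min_le_right _ _⟩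
  refine ⟨(ρ / δ + 1) ^ s / s + ρ ^ (s - 1) * (δ ^ (s - 1))⁻¹, by positivity, fun t => ?_⟩
  by_cases ht : |t| < δ
  · have h1 := hδ (y := ρ + t) (by simpa [Real.dist_eq] using lt_of_lt_of_le ht hδ1)
    have h2 : 0 < ρ + t := by
      have := (abs_lt.1 ht).1
      linarith
    simp only [add_sub_cancel_left, smul_eq_mul, Real.norm_eq_abs] at h1
    have h3 := (abs_le.1 h1).2
    rw [abs_of_pos h2]
    have h4 : 0 ≤ ((ρ / δ + 1) ^ s / s + ρ ^ (s - 1) * (δ ^ (s - 1))⁻¹) * |t| ^ s := by positivity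
    have h5 : (ρ + t) ^ s ≤ (ρ ^ s / s + ρ ^ (s - 1) * t + ε * |t|) * s := by
      have : ρ ^ s / s * s = ρ ^ s := by field_simp
      nlinarith
    have h6 := (div_le_iff₀ hs0).2 h5
    linarith
  · push Not at ht
    have htp : 0 < |t| := hδp.trans_le ht
    have h1 : |ρ + t| ≤ (ρ / δ + 1) * |t| := by
      have : |ρ + t| ≤ ρ + |t| := (abs_add_le _ _).trans (by rw [abs_of_pos hρ])
      have h2 : ρ ≤ ρ / δ * |t| := by
        rw [div_mul_eq_mul_div, le_div_iff₀ hδp]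
        exact mul_le_mul_of_nonneg_left ht hρ.le
      linarith
    have h2 : |ρ + t| ^ s ≤ (ρ / δ + 1) ^ s * |t| ^ s := by
      rw [← Real.mul_rpow (by positivity) (by positivity)]
      exact Real.rpow_le_rpow (abs_nonneg _) h1 hs0.le
    have h3 : |t| ≤ (δ ^ (s - 1))⁻¹ * |t| ^ s := by
      have e : |t| ^ s = |t| * |t| ^ (s - 1) := by
        rw [← Real.rpow_one_add' (abs_nonneg _) (by linarith)]; ring_nf
      have : δ ^ (s - 1) ≤ |t| ^ (s - 1) := Real.rpow_le_rpow hδp.le ht (by linarith)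
      have hp : 0 < δ ^ (s - 1) := by positivity
      rw [e, inv_mul_eq_div, le_div_iff₀ hp]
      exact mul_le_mul_of_nonneg_left this htp.le
    have h4 : -(ρ ^ (s - 1) * t) ≤ ρ ^ (s - 1) * ((δ ^ (s - 1))⁻¹ * |t| ^ s) := by
      have : -t ≤ (δ ^ (s - 1))⁻¹ * |t| ^ s := (neg_le_abs t).trans h3
      have := mul_le_mul_of_nonneg_left this (show 0 ≤ ρ ^ (s - 1) by positivity)
      linarith
    have h5 : |ρ + t| ^ s / s ≤ (ρ / δ + 1) ^ s / s * |t| ^ s := by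
      rw [div_mul_eq_mul_div]
      exact div_le_div_of_nonneg_right h2 hs0.le
    have h6 : 0 ≤ ρ ^ s / s := by positivity
    have h7 : 0 ≤ ε * |t| := by positivity
    linarith

lemma ptwise_aux {m s ρ K η κ ε C M r0 u X X' : ℝ} {k : ℕ} (hms : m.HolderConjugate s)
    (hρ : 0 < ρ) (hK : 0 < K) (hη : 1 < η) (hκ : 0 < κ) (hκ1 : κ < 1) (hε : 0 < ε) (hC : 0 ≤ C)
    (hT : ∀ t : ℝ, |ρ + t| ^ s / s ≤ ρ ^ s / s + ρ ^ (s - 1) * t + ε * |t| + C * |t| ^ s)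
    (hr0 : 0 < r0) (hu1 : 1 - κ ≤ u) (hu2 : u ≤ 1 + κ) (hX : 0 < X) (hX1 : X ≤ 1)
    (hk : s + 1 ≤ k) (hM : |k * X' - K * X / u| ≤ M) (y : ℝ) :
    -(k * X ^ (k - 1) * X' / r0 + (ρ - K / (r0 * u)) * X ^ k) * y - X ^ k * (|y| ^ m / m)
      + (ρ ^ (s - 1) * K * r0 ^ (η - 1) / η) * (r0 * u) ^ (-η) * X ^ k ≤
    (ρ ^ s / s + (-(ρ ^ (s - 1) * K) / (1 + κ)
      + (ρ ^ (s - 1) * K) / η * (1 - κ) ^ (-η)) / r0) * X ^ k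
      + ρ ^ (s - 1) * (k * X ^ (k - 1) * X' / r0) + (ε * M / r0 + C * M ^ s * r0 ^ (-s)) * X := by
  have hs : 1 < s := hms.symm.lt
  have hs0 : 0 < s := by linarith
  have hup : 0 < u := by linarith
  obtain ⟨j, rfl⟩ : ∃ j, k = j + 1 := by
    refine Nat.exists_eq_succ_of_ne_zero ?_
    rintro rfl
    simp at hk
    linarith
  have hM0 : 0 ≤ M := (abs_nonneg _).trans hM
  simp only [Nat.add_sub_cancel]
  set L := ((j + 1 : ℕ) : ℝ) * X' - K * X / u with hL
  set t := L / (r0 * X) with ht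
  set A := ρ ^ (s - 1) * K with hA
  have hAp : 0 < A := by positivity
  have hg : 0 < X ^ (j + 1) := by positivity
  have ht1 : X ^ (j + 1) * t = ((j + 1 : ℕ) : ℝ) * X ^ j * X' / r0 - K / (r0 * u) * X ^ (j + 1) := by
    rw [ht, hL, pow_succ]
    field_simp
  have habs : |t| ≤ M / (r0 * X) := by
    rw [ht, abs_div, abs_of_pos (show 0 < r0 * X by positivity)]
    gcongr
  -- Young
  have hy := Real.young_inequality (-y) (ρ + t) hms
  rw [abs_neg] at hy
  have h1 : -((ρ + t) * y) - |y| ^ m / m ≤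
      ρ ^ s / s + ρ ^ (s - 1) * t + ε * |t| + C * |t| ^ s := by
    have := hT t
    linarith
  have h2 := mul_le_mul_of_nonneg_left h1 hg.le
  -- X^j ≤ X
  have hj1 : 1 ≤ j := by
    have : (2 : ℝ) < ((j + 1 : ℕ) : ℝ) := by linarith
    have : 2 < j + 1 := by exact_mod_cast this
    omega
  have hXj : X ^ j ≤ X := pow_le_of_le_one hX.le hX1 (by omega)
  have h3 : X ^ (j + 1) * (ε * |t|) ≤ ε * M / r0 * X := by
    calc X ^ (j + 1) * (ε * |t|) ≤ X ^ (j + 1) * (ε * (M / (r0 * X))) := by gcongr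
      _ = ε * M / r0 * X ^ j := by rw [pow_succ]; field_simp
      _ ≤ _ := by gcongr
  have h4 : X ^ (j + 1) * (C * |t| ^ s) ≤ C * M ^ s * r0 ^ (-s) * X := by
    have e1 : |t| ^ s ≤ M ^ s * r0 ^ (-s) * (X ^ s)⁻¹ := by
      calc |t| ^ s ≤ (M / (r0 * X)) ^ s := Real.rpow_le_rpow (abs_nonneg _) habs hs0.le
        _ = _ := by
          rw [Real.div_rpow hM0 (by positivity), Real.mul_rpow hr0.le hX.le, Real.rpow_neg hr0.le,
            div_eq_mul_inv, mul_inv, mul_assoc]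
    have e2 : X ^ (j + 1) ≤ X ^ s * X := by
      rw [← Real.rpow_natCast, ← Real.rpow_add_one hX.ne']
      exact Real.rpow_le_rpow_of_exponent_ge hX hX1 hk
    have hXs : 0 < X ^ s := by positivity
    calc X ^ (j + 1) * (C * |t| ^ s) ≤ (X ^ s * X) * (C * (M ^ s * r0 ^ (-s) * (X ^ s)⁻¹)) := by
          gcongr
      _ = _ := by field_simp
  have h5 : (A * r0 ^ (η - 1) / η) * (r0 * u) ^ (-η) ≤ A / η * (1 - κ) ^ (-η) / r0 := by
    rw [Real.mul_rpow hr0.le hup.le]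
    have e1 : r0 ^ (η - 1) * r0 ^ (-η) = r0⁻¹ := by
      rw [← Real.rpow_add hr0, ← Real.rpow_neg_one]; ring_nf
    have e2 : u ^ (-η) ≤ (1 - κ) ^ (-η) :=
      Real.rpow_le_rpow_of_nonpos (by linarith) hu1 (by linarith)
    calc (A * r0 ^ (η - 1) / η) * (r0 ^ (-η) * u ^ (-η))
        = A / η * (r0 ^ (η - 1) * r0 ^ (-η)) * u ^ (-η) := by ring
      _ = A / η * r0⁻¹ * u ^ (-η) := by rw [e1]
      _ ≤ A / η * r0⁻¹ * (1 - κ) ^ (-η) := by gcongr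
      _ = _ := by ring
  have h5' := mul_le_mul_of_nonneg_right h5 hg.le
  have h6 : -(A / (r0 * u)) ≤ -A / (1 + κ) / r0 := by
    rw [neg_div, neg_div, neg_le_neg_iff, div_div, mul_comm (1 + κ)]
    gcongr
  have h6' := mul_le_mul_of_nonneg_right h6 hg.le
  have e0 : X ^ (j + 1) * (-((ρ + t) * y) - |y| ^ m / m) =
      -(((j + 1 : ℕ) : ℝ) * X ^ j * X' / r0 + (ρ - K / (r0 * u)) * X ^ (j + 1)) * y
        - X ^ (j + 1) * (|y| ^ m / m) := by
    linear_combination (-y) * ht1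
  rw [e0] at h2
  have e3 : X ^ (j + 1) * (ρ ^ (s - 1) * t) =
      ρ ^ (s - 1) * (((j + 1 : ℕ) : ℝ) * X ^ j * X' / r0) - A / (r0 * u) * X ^ (j + 1) := by
    rw [hA]
    linear_combination ρ ^ (s - 1) * ht1
  have e4 : X ^ (j + 1) * (ρ ^ s / s + ρ ^ (s - 1) * t + ε * |t| + C * |t| ^ s) =
     X ^ (j + 1) * (ρ ^ s / s) + X ^ (j + 1) * (ρ ^ (s - 1) * t) + X ^ (j + 1) * (ε * |t|)
      + X ^ (j + 1) * (C * |t| ^ s) := by ring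
  rw [e4, e3] at h2
  have e5 : (ρ ^ s / s + (-A / (1 + κ) + A / η * (1 - κ) ^ (-η)) / r0) * X ^ (j + 1) =
     X ^ (j + 1) * (ρ ^ s / s) + -A / (1 + κ) / r0 * X ^ (j + 1)
      + A / η * (1 - κ) ^ (-η) / r0 * X ^ (j + 1) := by ring
  rw [e5]
  linarith

lemma upper_bound {n : ℕ} {m s ρ R a η : ℝ} (hms : m.HolderConjugate s) (hρ : 0 < ρ) (hR : 0 < R)
    (hη : 1 < η) (ha : a < n)
    {b : Euc (n + 1) → Euc (n + 1)} {V : Euc (n + 1) → ℝ}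
    (hb : ∀ x, R ≤ ‖x‖ → b x = ((ρ + a * ‖x‖⁻¹) * ‖x‖⁻¹) • x)
    (hV : ∀ x, R ≤ ‖x‖ → V x = ‖x‖ ^ (-η)) {ε : ℝ} (hε : 0 < ε) :
    ∃ N : ℝ, ∀ r0, N ≤ r0 → ∀ lam φ,
      IsSubsol m b V (ρ ^ (s - 1) * (n - a) * r0 ^ (η - 1) / η) lam φ →
      lam ≤ ρ ^ s / s + (-(ρ ^ (s - 1) * (n - a)) + ρ ^ (s - 1) * (n - a) / η + ε) / r0 := by
  have hs : 1 < s := hms.symm.lt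
  have hK : 0 < (n : ℝ) - a := by linarith
  set K := (n : ℝ) - a with hKdef
  set A := ρ ^ (s - 1) * K with hA
  -- choose κ
  obtain ⟨κ, hκ0, hκ1, hκ⟩ : ∃ κ : ℝ, 0 < κ ∧ κ < 1 ∧
      -A / (1 + κ) + A / η * (1 - κ) ^ (-η) < -A + A / η + ε / 3 := by
    have hc : ContinuousAt (fun κ : ℝ => -A / (1 + κ) + A / η * (1 - κ) ^ (-η)) 0 := by
      refine (continuousAt_const.div (by fun_prop) (by norm_num)).add
        (continuousAt_const.mul (ContinuousAt.rpow_const (by fun_prop) (by norm_num)))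
    have h1 : ∀ᶠ κ in nhds (0 : ℝ),
        -A / (1 + κ) + A / η * (1 - κ) ^ (-η) < -A + A / η + ε / 3 := by
      refine hc.eventually (Iio_mem_nhds ?_)
      simp
      linarith
    obtain ⟨δ, hδ, h⟩ := Metric.eventually_nhds_iff.1 h1
    refine ⟨min (δ / 2) (1 / 2), by positivity, ?_, h ?_⟩
    · exact (min_le_right _ _).trans_lt (by norm_num)
    · rw [Real.dist_eq, sub_zero, abs_of_pos (by positivity)]
      exact (min_le_left _ _).trans_lt (by linarith)
  let χ : ContDiffBump (1 : ℝ) := ⟨κ / 2, κ, by positivity, by linarith⟩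
  have hχc : ContDiff ℝ 1 χ := χ.contDiff
  have hχcs : HasCompactSupport χ := χ.hasCompactSupport
  have hχd : Continuous (deriv χ) := hχc.continuous_deriv (by norm_num)
  obtain ⟨M0, hM0⟩ := hχd.bounded_above_of_compact_support hχcs.deriv
  obtain ⟨k, hk⟩ := exists_nat_ge (s + 1)
  have hk2 : 2 < k := by
    have : (2 : ℝ) < k := by linarith
    exact_mod_cast this
  have hχz : ∀ u, u ≤ 1 - κ → χ u = 0 := by
    intro u hu
    apply χ.zero_of_le_dist
    change κ ≤ dist u 1
    rw [Real.dist_eq, abs_of_nonpos (by linarith)]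
    linarith
  have hχs : ∀ u, χ u ≠ 0 → 1 - κ ≤ u ∧ u ≤ 1 + κ := by
    intro u hu
    have : u ∈ Metric.ball (1 : ℝ) χ.rOut := by rw [← χ.support_eq]; exact hu
    rw [Metric.mem_ball, Real.dist_eq] at this
    have := abs_lt.1 this
    change _ < _ ∧ _ < κ at this
    have h1 : -κ < u - 1 := this.1
    constructor <;> linarith [this.2]
  set M := k * M0 + K / (1 - κ) with hM
  have hκ' : 0 < 1 - κ := by linarith
  have hM00 : 0 ≤ M0 := (norm_nonneg _).trans (hM0 0)
  have hMp : 0 ≤ M := by positivity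
  have hMb : ∀ u, χ u ≠ 0 → |k * deriv χ u - K * χ u / u| ≤ M := by
    intro u hu
    have hu' := (hχs u hu).1
    have hup : 0 < u := by linarith
    refine (abs_sub _ _).trans (add_le_add ?_ ?_)
    · rw [abs_mul, Nat.abs_cast]
      exact mul_le_mul_of_nonneg_left (hM0 u) (by positivity)
    · rw [abs_of_nonneg (div_nonneg (mul_nonneg hK.le χ.nonneg) hup.le)]
      have : K * χ u ≤ K := mul_le_of_le_one_right hK.le χ.le_one
      gcongr
  set I1 := ∫ u, χ u ^ k with hI1
  set I2 := ∫ u, χ u with hI2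
  have hI1p : 0 < I1 := by
    have hc : HasCompactSupport fun u => χ u ^ k :=
      hχcs.comp_left (g := fun z : ℝ => z ^ k) (by simp; omega)
    refine Continuous.integral_pos_of_hasCompactSupport_nonneg_nonzero (x := 1)
      (χ.continuous.pow k) hc (fun u => pow_nonneg χ.nonneg k) ?_
    have : χ 1 = 1 := χ.one_of_mem_closedBall (by simp [χ.rIn_pos.le])
    simp [this]
  have hI2p : 0 ≤ I2 := MeasureTheory.integral_nonneg fun u => χ.nonneg
  set ε1 := ε * I1 / (3 * (M * I2 + 1)) with hε1
  have hε1p : 0 < ε1 := by positivity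
  obtain ⟨C, hC, hT⟩ := taylor_aux hs hρ hε1p
  -- N
  have hlim : Tendsto (fun r0 : ℝ => C * M ^ s * r0 ^ (-(s - 1)) * I2) atTop (nhds 0) := by
    have := (tendsto_rpow_neg_atTop (show 0 < s - 1 by linarith)).const_mul (C * M ^ s)
    simpa using this.mul_const I2
  have hev := hlim.eventually (Iio_mem_nhds (show 0 < ε * I1 / 3 by positivity))
  obtain ⟨N1, hN1⟩ := eventually_atTop.1 hev
  refine ⟨max N1 (R / (1 - κ) + 1), fun r0 hr0 lam φ hφ => ?_⟩
  have hN1' : C * M ^ s * r0 ^ (-(s - 1)) * I2 < ε * I1 / 3 :=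
    hN1 r0 ((le_max_left _ _).trans hr0)
  have hr0R : R / (1 - κ) < r0 := by linarith [(le_max_right N1 (R / (1 - κ) + 1)).trans hr0]
  have hr0p : 0 < r0 := lt_trans (by positivity) hr0R
  have hRr1 : R < (1 - κ) * r0 := by rwa [div_lt_iff₀' hκ'] at hr0R
  let g : ℝ → ℝ := fun r => χ (r / r0) ^ k
  have hg : ContDiff ℝ 1 g := (hχc.comp (contDiff_id.div_const r0)).pow k
  have hgd : ∀ r, deriv g r = k * χ (r / r0) ^ (k - 1) * deriv χ (r / r0) / r0 := by
    intro r
    have h1 : HasDerivAt χ (deriv χ (r / r0)) (r / r0) :=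
      (hχc.differentiable (by norm_num)).differentiableAt.hasDerivAt
    have h2 := ((h1.comp r ((hasDerivAt_id r).div_const r0)).pow k).deriv
    change deriv g r = _ at h2
    rw [h2]
    simp
    ring
  have hscale : ∀ f : ℝ → ℝ, HasCompactSupport f → HasCompactSupport fun r => f (r / r0) := by
    intro f hf
    have := hf.comp_homeomorph (Homeomorph.mulRight₀ r0⁻¹ (inv_ne_zero hr0p.ne'))
    simpa [Function.comp_def, div_eq_mul_inv] using this
  have hxc : HasCompactSupport fun r => χ (r / r0) := hscale _ hχcs
  have hgc : HasCompactSupport g := hxc.comp_left (g := fun z : ℝ => z ^ k) (by simp; omega)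
  have hgdc : HasCompactSupport (deriv g) := hgc.deriv
  have hgdcont : Continuous (deriv g) := hg.continuous_deriv (by norm_num)
  have hxcont : Continuous fun r => χ (r / r0) := χ.continuous.comp (continuous_id.div_const r0)
  set c0 := ρ ^ s / s + (-A / (1 + κ) + A / η * (1 - κ) ^ (-η)) / r0 with hc0
  set c2 := ε1 * M / r0 + C * M ^ s * r0 ^ (-s) with hc2
  have hz : ∀ r ≤ (1 - κ) * r0, χ (r / r0) = 0 := by
    intro r hr
    apply hχz
    rwa [div_le_iff₀ hr0p]
  have ig : MeasureTheory.Integrable g := hg.continuous.integrable_of_hasCompactSupport hgc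
  have igd : MeasureTheory.Integrable (deriv g) := hgdcont.integrable_of_hasCompactSupport hgdc
  have ix : MeasureTheory.Integrable fun r => χ (r / r0) :=
    hxcont.integrable_of_hasCompactSupport hxc
  have main := integral_ineq (P := fun r => c0 * g r + ρ ^ (s - 1) * deriv g r + c2 * χ (r / r0))
    hms.lt hR hb hV hφ hg (fun r => pow_nonneg χ.nonneg k) hgc hRr1
    (fun r hr => by simp [g, hz r hr]; omega)
    (by
      have := hg.continuous
      fun_prop)
    (((hgc.mul_left (f := fun _ => c0)).add (hgdc.mul_left (f := fun _ => ρ ^ (s - 1)))).add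
      (hxc.mul_left (f := fun _ => c2)))
    (fun r hr => by
      have h0 := hz r (hr.trans hRr1.le)
      have hkk : k - 1 ≠ 0 := by omega
      have hk0 : k ≠ 0 := by omega
      simp [hgd, g, h0, hkk, hk0])
    (by
      intro r hr y
      rw [hgd]
      by_cases hX : χ (r / r0) = 0
      · have hkk : k - 1 ≠ 0 := by omega
        have hk0 : k ≠ 0 := by omega
        simp [g, hX, hkk, hk0]
      · have hX' : 0 < χ (r / r0) := lt_of_le_of_ne χ.nonneg (Ne.symm hX)
        have := ptwise_aux (X' := deriv χ (r / r0)) hms hρ hK hη hκ0 hκ1 hε1p hC hT hr0p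
          (hχs _ hX).1 (hχs _ hX).2 hX' χ.le_one hk (hMb _ hX) y
        have er : r0 * (r / r0) = r := by field_simp
        rw [er] at this
        exact this)
  have e1 : ∫ r, g r = r0 * I1 := by
    have := MeasureTheory.Measure.integral_comp_div (fun u => χ u ^ k) r0
    rw [abs_of_pos hr0p] at this
    exact this
  have e2 : ∫ r, χ (r / r0) = r0 * I2 := by
    have := MeasureTheory.Measure.integral_comp_div (fun u => χ u) r0
    rw [abs_of_pos hr0p] at this
    exact this
  have e3 : ∫ r, deriv g r = 0 := MeasureTheory.integral_eq_zero_of_hasDerivAt_of_integrable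
    (fun r => (hg.differentiable (by norm_num)).differentiableAt.hasDerivAt) igd ig
  have e4 : ∫ r, (c0 * g r + ρ ^ (s - 1) * deriv g r + c2 * χ (r / r0)) =
      c0 * (r0 * I1) + c2 * (r0 * I2) := by
    have i12 := (ig.const_mul c0).add (igd.const_mul (ρ ^ (s - 1)))
    simp only [Pi.add_def] at i12
    rw [MeasureTheory.integral_add i12 (ix.const_mul c2),
      MeasureTheory.integral_add (ig.const_mul c0) (igd.const_mul _),
      MeasureTheory.integral_const_mul, MeasureTheory.integral_const_mul,
      MeasureTheory.integral_const_mul, e1, e2, e3]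
    ring
  rw [e4, e1] at main
  have e5 : c2 * r0 = ε1 * M + C * M ^ s * r0 ^ (-(s - 1)) := by
    have : r0 ^ (-(s - 1)) = r0 ^ (-s) * r0 := by
      rw [← Real.rpow_add_one hr0p.ne']; ring_nf
    rw [hc2, this]
    field_simp
  have e6 : ε1 * M * I2 ≤ ε * I1 / 3 := by
    have : ε1 * (M * I2 + 1) = ε * I1 / 3 := by
      rw [hε1]; field_simp
    linarith
  have e7 : c2 * (r0 * I2) ≤ 2 * ε / 3 * I1 := by
    have : c2 * (r0 * I2) = ε1 * M * I2 + C * M ^ s * r0 ^ (-(s - 1)) * I2 := by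
      rw [← mul_assoc, e5]; ring
    rw [this]; linarith
  have e8 : lam * r0 * I1 ≤ (c0 * r0 + 2 * ε / 3) * I1 := by linarith
  have e9 := le_of_mul_le_mul_right e8 hI1p
  have e10 : c0 * r0 = ρ ^ s / s * r0 + (-A / (1 + κ) + A / η * (1 - κ) ^ (-η)) := by
    rw [hc0]; field_simp
  have e11 : lam * r0 ≤ ρ ^ s / s * r0 + (-A + A / η + ε) := by linarith
  have e12 : lam ≤ (ρ ^ s / s * r0 + (-A + A / η + ε)) / r0 := (le_div_iff₀ hr0p).2 e11
  refine e12.trans (le_of_eq ?_)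
  field_simp


lemma lower_bound {n : ℕ} {m s ρ R a η : ℝ} (hms : m.HolderConjugate s) (hρ : 0 < ρ) (hR : 0 < R)
    (hη : 1 < η) (ha : a < n)
    {b : Euc (n + 1) → Euc (n + 1)} {V : Euc (n + 1) → ℝ} (hbc : Continuous b) (hVc : Continuous V)
    (hVpos : ∀ x, ‖x‖ ≤ R → 0 < V x)
    (hb : ∀ x, R ≤ ‖x‖ → b x = ((ρ + a * ‖x‖⁻¹) * ‖x‖⁻¹) • x)
    (hV : ∀ x, R ≤ ‖x‖ → V x = ‖x‖ ^ (-η)) :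
    ∃ N : ℝ, ∀ r0, N ≤ r0 → ∃ φ,
      IsSubsol m b V (ρ ^ (s - 1) * (n - a) * r0 ^ (η - 1) / η)
        (ρ ^ s / s + (-(ρ ^ (s - 1) * (n - a)) + ρ ^ (s - 1) * (n - a) / η) / r0) φ := by
  have hs : 1 < s := hms.symm.lt
  have hm : 1 < m := hms.lt
  have hK : 0 < (n : ℝ) - a := by linarith
  set p := ρ ^ (s - 1) with hp
  have hpp : 0 < p := by positivity
  set A := p * (n - a) with hA
  have hAp : 0 < A := by positivity
  let f : ContDiffBump (0 : Euc (n + 1)) := ⟨R / 2, R, by positivity, by linarith⟩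
  let φ : Euc (n + 1) → ℝ := fun x => -p * ‖x‖ * (1 - f x)
  have hφ3 : ContDiff ℝ 3 φ := by
    rw [contDiff_iff_contDiffAt]
    intro x
    by_cases hx : x = 0
    · have : φ =ᶠ[nhds x] fun _ => 0 := by
        rw [hx]
        filter_upwards [f.eventuallyEq_one] with y hy
        simp [φ, hy]
      exact contDiffAt_const.congr_of_eventuallyEq this
    · exact (contDiffAt_const.mul (contDiffAt_norm ℝ hx)).mul (contDiffAt_const.sub f.contDiffAt)
  have hφo : ∀ x, R < ‖x‖ → φ =ᶠ[nhds x] fun y => -p * ‖y‖ := by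
    intro x hx
    filter_upwards [(isOpen_lt continuous_const continuous_norm).mem_nhds hx] with y hy
    have : f y = 0 := f.zero_of_le_dist (by
      rw [dist_zero_right]
      exact le_of_lt hy)
    simp [φ, this]
  have hcpt : IsCompact (Metric.closedBall (0 : Euc (n + 1)) R) := isCompact_closedBall _ _
  have hne : (Metric.closedBall (0 : Euc (n + 1)) R).Nonempty := ⟨0, by simp [hR.le]⟩
  obtain ⟨x0, hx0, hmin⟩ := hcpt.exists_isMinOn hne hVc.continuousOn
  have hv0 : 0 < V x0 := hVpos x0 (by simpa using hx0)
  have hGc : Continuous fun x => -lap φ x + ⟪b x, gradient φ x⟫ + (1 / m) * ‖gradient φ x‖ ^ m := by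
    have h1 := continuous_lap hφ3
    have h2 := continuous_gradient_aux hφ3
    refine (h1.neg.add (hbc.inner h2)).add (continuous_const.mul
      (h2.norm.rpow_const fun x => Or.inr (by linarith)))
  obtain ⟨x1, hx1, hmax⟩ := hcpt.exists_isMaxOn hne hGc.continuousOn
  set B1 := -lap φ x1 + ⟪b x1, gradient φ x1⟫ + (1 / m) * ‖gradient φ x1‖ ^ m with hB1
  have hlim : Tendsto (fun r0 : ℝ => A * r0 ^ (η - 1) / η * V x0) atTop atTop := by
    have h1 := (tendsto_rpow_atTop (show 0 < η - 1 by linarith)).const_mul_atTop hAp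
    have h2 := h1.atTop_div_const (show 0 < η by linarith)
    exact h2.atTop_mul_const hv0
  obtain ⟨N, hN⟩ := eventually_atTop.1 (hlim.eventually_ge_atTop (ρ ^ s / s + B1))
  refine ⟨max N 1, fun r0 hr0 => ⟨φ, hφ3, fun x => ?_⟩⟩
  have hr0p : 0 < r0 := by linarith [(le_max_right N 1).trans hr0]
  by_cases hx : ‖x‖ ≤ R
  · have hxm : x ∈ Metric.closedBall (0 : Euc (n + 1)) R := by simpa using hx
    have h1 : -lap φ x + ⟪b x, gradient φ x⟫ + (1 / m) * ‖gradient φ x‖ ^ m ≤ B1 := hmax hxm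
    have h2 : V x0 ≤ V x := hmin hxm
    have h3 := hN r0 ((le_max_left _ _).trans hr0)
    have h4 : A * r0 ^ (η - 1) / η * V x0 ≤ A * r0 ^ (η - 1) / η * V x := by gcongr
    have h5 : (-A + A / η) / r0 ≤ 0 := by
      apply div_nonpos_of_nonpos_of_nonneg _ hr0p.le
      have : A / η ≤ A := div_le_self hAp.le hη.le
      linarith
    linarith
  · push Not at hx
    have hx0' : x ≠ 0 := by
      intro h; simp [h] at hx; linarith
    have hpos : 0 < ‖x‖ := norm_pos_iff.2 hx0'
    rw [lap_congr (hφo x hx), gradient_congr (hφo x hx), lap_neg_norm p hx0',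
      gradient_neg_norm p hx0', hb x hx.le, hV x hx.le, inner_smul_left, inner_smul_right,
      real_inner_self_eq_norm_sq, norm_smul]
    simp only [conj_trivial, norm_mul, norm_neg, norm_inv, Real.norm_eq_abs,
      abs_of_pos hpp, abs_of_pos hpos]
    set r := ‖x‖
    have e1 : p * r⁻¹ * r = p := by field_simp
    have e2 : p ^ m = ρ ^ s := by
      rw [hp, ← Real.rpow_mul hρ.le]
      congr 1
      exact hms.symm.sub_one_mul_conj
    have e3 : (ρ + a * r⁻¹) * r⁻¹ * (-p * r⁻¹ * r ^ 2) = -(ρ * p) - a * p / r := by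
      field_simp
      ring
    have e4 : ρ * p = ρ ^ s := by
      rw [hp, ← Real.rpow_one_add' hρ.le (by linarith)]; ring_nf
    rw [e1, e2, e3, e4]
    have e5 : A * r0 ^ (η - 1) / η * r ^ (-η) = A / (η * r0) * (r0 / r) ^ η := by
      rw [Real.div_rpow hr0p.le hpos.le, Real.rpow_neg hpos.le, Real.rpow_sub_one hr0p.ne']
      field_simp
    have e6 := one_add_mul_self_le_rpow_one_add (s := r0 / r - 1) (p := η)
      (by have : 0 < r0 / r := by positivity
          linarith) hη.le
    rw [add_sub_cancel] at e6
    have e7 : A / (η * r0) * (1 + η * (r0 / r - 1)) ≤ A / (η * r0) * (r0 / r) ^ η := by gcongr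
    rw [← e5] at e7
    have e8 : A / (η * r0) * (1 + η * (r0 / r - 1)) = (A / η) / r0 + A / r - A / r0 := by
      field_simp
      ring
    rw [e8] at e7
    have e9 : ρ ^ s / s = ρ ^ s - 1 / m * ρ ^ s := by
      have := hms.inv_add_inv_eq_one
      have h : s⁻¹ = 1 - m⁻¹ := by linarith
      rw [div_eq_mul_inv, h]
      ring
    have e10 : -p * ((((n + 1 : ℕ) : ℝ) - 1) / r) = -(A / r) - a * p / r := by
      rw [hA]; push_cast; ring
    have e11 : (-A + A / η) / r0 = -(A / r0) + (A / η) / r0 := by ring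
    rw [e10, e11]
    linarith

/-- sharp asymptotics of `ρ^{m*}/m* - λ_max(β)` in the moderate drift case
with `η > 1` and `a < d - 1`. -/
theorem stmt16 (d : ℕ) (hd : 1 ≤ d) (m ρ R a η : ℝ) (hm : 1 < m)
    (hρ : 0 < ρ) (hη : 0 < η) (hR : 0 < R)
    (mst : ℝ) (hmst : mst = m / (m - 1))
    (b : Euc d → Euc d) (V : Euc d → ℝ) (α : Euc d → ℝ)
    (hH1 : HypH1 0 ρ R a η b V α)
    (hη1 : 1 < η) (ha : a < (d : ℝ) - 1)
    (c₁ : ℝ) (hc₁ : c₁ = (η - 1) * (ρ ^ (mst - 1) * ((d : ℝ) - 1 - a) / η) ^ (η / (η - 1))) :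
    Tendsto (fun β : ℝ => β ^ (1 / (η - 1)) * (ρ ^ mst / mst - lamMax m b V β))
      atTop (nhds c₁) := by
  obtain ⟨n, rfl⟩ : ∃ n, d = n + 1 := ⟨d - 1, by omega⟩
  obtain ⟨⟨hb2, hV2, -, -, hb, -, -, hsupp, -⟩, hαV⟩ := hH1.imp_left id
  have hV0 : ∀ x, 0 ≤ V x := hH1.1.2.2.2.2.2.2.1
  have hms : m.HolderConjugate mst := by
    rw [hmst]
    exact (Real.holderConjugate_iff_eq_conjExponent hm).2 rfl
  have hcast : (((n + 1 : ℕ) : ℝ) - 1) = n := by push_cast; ring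
  rw [hcast] at ha hc₁
  have hb' : ∀ x, R ≤ ‖x‖ → b x = ((ρ + a * ‖x‖⁻¹) * ‖x‖⁻¹) • x := by
    intro x hx
    rw [hb x hx, (hαV x hx).1, zero_sub, Real.rpow_neg_one]
  have hV' : ∀ x, R ≤ ‖x‖ → V x = ‖x‖ ^ (-η) := fun x hx => (hαV x hx).2
  have hVpos : ∀ x, ‖x‖ ≤ R → 0 < V x := by
    intro x hx
    have h1 : x ∈ Function.support V :=
      interior_subset (hsupp (by simpa using hx))
    exact lt_of_le_of_ne (hV0 x) (Ne.symm h1)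
  set A := ρ ^ (mst - 1) * (n - a) with hA
  have hK : 0 < (n : ℝ) - a := by linarith
  have hAp : 0 < A := by positivity
  set Λ := ρ ^ mst / mst with hΛ
  have hη' : 0 < η - 1 := by linarith
  set D := (A / η) ^ (1 / (η - 1)) with hD
  have hDp : 0 < D := by positivity
  have hc : c₁ = D * (A - A / η) := by
    rw [hc₁, show η / (η - 1) = 1 / (η - 1) + 1 by field_simp; ring,
      Real.rpow_add_one (by positivity), ← hD]
    field_simp
  obtain ⟨N1, hN1⟩ := lower_bound hms hρ hR hη1 ha hb2.continuous hV2.continuous hVpos hb' hV'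
  let r0 : ℝ → ℝ := fun β => β ^ (1 / (η - 1)) / D
  have hr0 : Tendsto r0 atTop atTop :=
    (tendsto_rpow_atTop (by positivity)).atTop_div_const hDp
  have hβ : ∀ β : ℝ, 0 < β → A * r0 β ^ (η - 1) / η = β := by
    intro β hβ
    have h1 : r0 β ^ (η - 1) = β / (A / η) := by
      simp only [r0, hD]
      rw [← Real.div_rpow hβ.le (by positivity), ← Real.rpow_mul (by positivity),
        one_div_mul_cancel hη'.ne', Real.rpow_one]
    rw [h1]
    field_simp
  rw [Metric.tendsto_atTop']
  intro ε hε
  set ε' := ε / (2 * D) with hε'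
  have hε'p : 0 < ε' := by positivity
  obtain ⟨N2, hN2⟩ := upper_bound hms hρ hR hη1 ha hb' hV' hε'p
  obtain ⟨β0, hβ0⟩ := eventually_atTop.1
    ((hr0.eventually_ge_atTop (max N1 N2)).and (eventually_gt_atTop 0))
  refine ⟨β0, fun β hβ1 => ?_⟩
  obtain ⟨hrN, hβp⟩ := hβ0 β (le_of_lt hβ1)
  obtain ⟨φ, hφ⟩ := hN1 (r0 β) ((le_max_left _ _).trans hrN)
  have hup := hN2 (r0 β) ((le_max_right _ _).trans hrN)
  rw [← hA, ← hΛ, hβ β hβp] at hφ hup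
  have hr0p : 0 < r0 β := by positivity
  have hbdd : BddAbove {lam : ℝ | ∃ φ : Euc (n + 1) → ℝ, IsSubsol m b V β lam φ} :=
    ⟨_, fun lam ⟨φ, h⟩ => hup lam φ h⟩
  have h1 : Λ + (-A + A / η) / r0 β ≤ lamMax m b V β := le_csSup hbdd ⟨φ, hφ⟩
  have h2 : lamMax m b V β ≤ Λ + (-A + A / η + ε') / r0 β :=
    csSup_le ⟨_, φ, hφ⟩ fun lam ⟨φ, h⟩ => hup lam φ h
  have hB : β ^ (1 / (η - 1)) = r0 β * D := by
    simp only [r0]; field_simp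
  rw [hB, Real.dist_eq, hc]
  set L := lamMax m b V β
  set r := r0 β
  have h3 : -A + A / η ≤ (L - Λ) * r := by
    rw [← div_le_iff₀ hr0p]; linarith
  have h4 : (L - Λ) * r ≤ -A + A / η + ε' := by
    rw [← le_div_iff₀ hr0p]; linarith
  have h5 := mul_le_mul_of_nonneg_left h3 hDp.le
  have h6 := mul_le_mul_of_nonneg_left h4 hDp.le
  have h7 : D * ε' = ε / 2 := by rw [hε']; field_simp
  rw [abs_lt]
  constructor <;> nlinarith

end
end

section
/- Let d ≥ 1, m > 1, m* = m/(m−1), and suppose (b,V) satisfies hypothesis (H1) with parameters δ = 0, ρ > 0, a ∈ ℝ, η > 0, R > 0, with η > 1 and a < d − 1. Then limsup_{β→∞} β^{1/(η−1)} (ρ^{m*}/m* − λ_max(β)) ≤ c₁, where c₁ := (η−1) · (ρ^{m*−1}(d−1−a)/η)^{η/(η−1)}. -/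
open Filter Real RealInnerProductSpace

noncomputable section

/-- Young inequality in the form needed. -/
lemma aux_young (η A β r : ℝ) (hη : 1 < η) (hA : 0 < A) (hβ : 0 < β) (hr : 0 < r) :
    A / r ≤ β * r ^ (-η) + (η - 1) * (A / η) ^ (η / (η - 1)) * β ^ (-(1 / (η - 1))) := by
  have h0 : 0 < η := by linarith
  have h1 : 0 < η - 1 := by linarith
  have hpq : η.HolderConjugate (η / (η - 1)) := Real.HolderConjugate.conjExponent hη
  set c : ℝ := (β * η) ^ (1 / η) with hc
  have hcpos : 0 < c := by positivity
  have hy := Real.young_inequality_of_nonneg (a := c / r) (b := A / c)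
    (by positivity) (by positivity) hpq
  have e1 : c / r * (A / c) = A / r := by field_simp
  have e2 : (c / r) ^ η / η = β * r ^ (-η) := by
    rw [Real.div_rpow hcpos.le hr.le, hc, ← Real.rpow_mul (by positivity),
      one_div_mul_cancel h0.ne', Real.rpow_one, Real.rpow_neg hr.le]
    field_simp
  have e3 : (A / c) ^ (η / (η - 1)) / (η / (η - 1))
      = (η - 1) * (A / η) ^ (η / (η - 1)) * β ^ (-(1 / (η - 1))) := by
    have hq : η / (η - 1) = 1 + 1 / (η - 1) := by field_simp; ring
    have e4 : c ^ (η / (η - 1)) = β ^ (1 / (η - 1)) * η ^ (1 / (η - 1)) := by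
      rw [hc, ← Real.rpow_mul (by positivity), ← Real.mul_rpow hβ.le h0.le]
      congr 1
      field_simp
    have e5 : η ^ (η / (η - 1)) = η * η ^ (1 / (η - 1)) := by
      rw [hq, Real.rpow_add h0, Real.rpow_one]
    rw [Real.div_rpow hA.le hcpos.le, Real.div_rpow hA.le h0.le, e4, e5, Real.rpow_neg hβ.le]
    have := Real.rpow_pos_of_pos hβ (1 / (η - 1))
    have := Real.rpow_pos_of_pos h0 (1 / (η - 1))
    field_simp
  rw [e1, e2, e3] at hy
  exact hy

/-- The smooth cutoff test function. -/
def testφ (d : ℕ) (κ R : ℝ) (x : Euc d) : ℝ :=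
  -κ * (Real.smoothTransition (4 * ‖x‖ ^ 2 / R ^ 2 - 1) * ‖x‖)

lemma testφ_contDiff (d : ℕ) (κ R : ℝ) (hR : 0 < R) : ContDiff ℝ 3 (testφ d κ R) := by
  rw [contDiff_iff_contDiffAt]
  intro x
  by_cases hx : x = 0
  · subst hx
    have : testφ d κ R =ᶠ[nhds 0] fun _ => 0 := by
      filter_upwards [Metric.ball_mem_nhds (0 : Euc d) (show 0 < R / 2 by positivity)] with y hy
      have hy' : ‖y‖ < R / 2 := by simpa using hy
      have : 4 * ‖y‖ ^ 2 / R ^ 2 - 1 ≤ 0 := by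
        rw [sub_nonpos, div_le_one (by positivity)]
        nlinarith [norm_nonneg y]
      simp [testφ, Real.smoothTransition.zero_of_nonpos this]
    exact contDiffAt_const.congr_of_eventuallyEq this
  · unfold testφ
    refine contDiffAt_const.mul (ContDiffAt.mul ?_ (contDiffAt_norm ℝ hx))
    refine Real.smoothTransition.contDiffAt.comp x ?_
    exact (((contDiff_const.mul (contDiff_norm_sq ℝ)).div_const _).sub contDiff_const).contDiffAt

lemma testφ_eventually (d : ℕ) (κ R : ℝ) (hR : 0 < R) (x : Euc d) (hx : R ≤ ‖x‖) :
    ∀ᶠ y in nhds x, y ≠ 0 ∧ testφ d κ R =ᶠ[nhds y] fun z => -κ * ‖z‖ := by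
  have hopen : IsOpen {y : Euc d | R * (3 / 4) < ‖y‖} := isOpen_lt continuous_const continuous_norm
  have hxm : x ∈ {y : Euc d | R * (3 / 4) < ‖y‖} := by
    simp only [Set.mem_ofPred_eq]; linarith
  filter_upwards [hopen.mem_nhds hxm] with y hy
  refine ⟨fun h => ?_, ?_⟩
  · subst h
    simp at hy
    linarith
  · filter_upwards [hopen.mem_nhds hy] with z hz
    replace hz : R * (3 / 4) < ‖z‖ := hz
    have : 1 ≤ 4 * ‖z‖ ^ 2 / R ^ 2 - 1 := by
      rw [le_sub_iff_add_le, le_div_iff₀ (by positivity)]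
      nlinarith [norm_nonneg z]
    simp [testφ, Real.smoothTransition.one_of_one_le this]

lemma hasGradientAt_norm' (d : ℕ) (κ : ℝ) (x : Euc d) (hx : x ≠ 0) :
    HasGradientAt (fun z : Euc d => -κ * ‖z‖) ((-κ / ‖x‖) • x) x := by
  have hn : ‖x‖ ≠ 0 := norm_ne_zero_iff.mpr hx
  have h1 : HasFDerivAt (fun z : Euc d => ‖z‖ ^ 2) (2 • innerSL ℝ x) x :=
    (hasStrictFDerivAt_norm_sq x).hasFDerivAt
  have h2 := (h1.sqrt (by positivity)).const_mul (-κ)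
  rw [hasGradientAt_iff_hasFDerivAt]
  refine (h2.congr_fderiv ?_).congr_of_eventuallyEq ?_
  · ext v
    simp [Real.sqrt_sq (norm_nonneg x), real_inner_smul_left, -map_smul]
    field_simp
  · filter_upwards with z
    simp [Real.sqrt_sq (norm_nonneg z)]

lemma testφ_gradient (d : ℕ) (κ R : ℝ) (hR : 0 < R) (x : Euc d) (hx : R ≤ ‖x‖) :
    gradient (testφ d κ R) x = (-κ / ‖x‖) • x := by
  obtain ⟨h0, h⟩ := (testφ_eventually d κ R hR x hx).self_of_nhds
  exact ((hasGradientAt_norm' d κ x h0).congr_of_eventuallyEq h).gradient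

lemma testφ_lap (d : ℕ) (κ R : ℝ) (hR : 0 < R) (x : Euc d) (hx : R ≤ ‖x‖) :
    lap (testφ d κ R) x = -κ * ((d : ℝ) - 1) / ‖x‖ := by
  have hev := testφ_eventually d κ R hR x hx
  have h0 := hev.self_of_nhds.1
  have hn : ‖x‖ ≠ 0 := norm_ne_zero_iff.mpr h0
  have key : ∀ i : Fin d, fderiv ℝ (fun y => fderiv ℝ (testφ d κ R) y (EuclideanSpace.single i 1)) x
      (EuclideanSpace.single i 1) = -κ * (1 / ‖x‖ - (x i) ^ 2 / ‖x‖ ^ 3) := by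
    intro i
    have e : (fun y => fderiv ℝ (testφ d κ R) y (EuclideanSpace.single i 1))
        =ᶠ[nhds x] fun y => -κ * (y i * ‖y‖⁻¹) := by
      filter_upwards [hev] with y hy
      have hg := ((hasGradientAt_norm' d κ y hy.1).congr_of_eventuallyEq hy.2).hasFDerivAt
      rw [hg.fderiv]
      simp [real_inner_smul_left, -map_smul, EuclideanSpace.inner_single_right]
      ring
    rw [e.fderiv_eq]
    have hnorm := (hasGradientAt_norm' d (-1) x h0).hasFDerivAt
    simp only [neg_neg, one_mul] at hnorm
    have hinv := (hasDerivAt_inv hn).comp_hasFDerivAt x hnorm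
    have hcoord : HasFDerivAt (fun y : Euc d => y i) (EuclideanSpace.proj (𝕜 := ℝ) i) x :=
      (EuclideanSpace.proj (𝕜 := ℝ) i : Euc d →L[ℝ] ℝ).hasFDerivAt
    have hprod := (hcoord.mul hinv).const_mul (-κ)
    have := hprod.fderiv
    simp only [Function.comp_def] at this
    erw [this]
    simp [real_inner_smul_left, -map_smul, EuclideanSpace.inner_single_right]
    field_simp
    try ring
  unfold lap
  simp_rw [key]
  rw [← Finset.mul_sum, Finset.sum_sub_distrib, ← Finset.sum_div, ← Finset.sum_div]
  have : ∑ i, (x i) ^ 2 = ‖x‖ ^ 2 := by rw [EuclideanSpace.real_norm_sq_eq]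
  rw [this]
  simp
  field_simp

/-- Subsolution for large β. -/
lemma aux_subsol (d : ℕ) (m ρ R a η : ℝ) (hm : 1 < m)
    (hρ : 0 < ρ) (hR : 0 < R)
    (mst : ℝ) (hmst : mst = m / (m - 1))
    (b : Euc d → Euc d) (V : Euc d → ℝ) (α : Euc d → ℝ)
    (hH1 : HypH1 0 ρ R a η b V α)
    (hη1 : 1 < η) (ha : a < (d : ℝ) - 1)
    (c₁ : ℝ) (hc₁ : c₁ = (η - 1) * (ρ ^ (mst - 1) * ((d : ℝ) - 1 - a) / η) ^ (η / (η - 1))) :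
    ∀ᶠ β : ℝ in atTop, IsSubsol m b V β (ρ ^ mst / mst - c₁ * β ^ (-(1 / (η - 1))))
      (testφ d (ρ ^ (mst - 1)) R) := by
  obtain ⟨⟨hb, hV, -, -, hbe, -, hV0, hsupp, -⟩, hout⟩ := hH1
  set κ := ρ ^ (mst - 1) with hκ
  have hκ0 : 0 < κ := by positivity
  have hm1 : 0 < m - 1 := by linarith
  have hη0 : 0 < η - 1 := by linarith
  have hA : 0 < κ * ((d : ℝ) - 1 - a) := mul_pos hκ0 (by linarith)
  have hc0 : 0 ≤ c₁ := by
    rw [hc₁]; positivity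
  set φ := testφ d κ R with hφ
  have hφc : ContDiff ℝ 3 φ := testφ_contDiff d κ R hR
  have hcpt : IsCompact (Metric.closedBall (0 : Euc d) R) := isCompact_closedBall 0 R
  have hne : (Metric.closedBall (0 : Euc d) R).Nonempty := ⟨0, by simp [hR.le]⟩
  have hgrad : Continuous (gradient φ) := by
    unfold gradient
    exact (LinearIsometryEquiv.continuous _).comp (hφc.continuous_fderiv (by norm_num))
  have hlap : Continuous (lap φ) := by
    unfold lap
    refine continuous_finsetSum _ fun i _ => ?_
    have h1 : ContDiff ℝ 2 (fun y => fderiv ℝ φ y (EuclideanSpace.single i 1)) :=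
      (hφc.fderiv_right (by norm_num)).clm_apply contDiff_const
    exact (h1.continuous_fderiv (by norm_num)).clm_apply continuous_const
  have hcont : Continuous fun x => - lap φ x + ⟪b x, gradient φ x⟫ + (1 / m) * ‖gradient φ x‖ ^ m := by
    refine (hlap.neg.add (hb.continuous.inner hgrad)).add (continuous_const.mul ?_)
    exact hgrad.norm.rpow_const fun x => Or.inr (by linarith)
  obtain ⟨x1, -, hx1⟩ := hcpt.exists_isMaxOn hne hcont.continuousOn
  obtain ⟨x2, hx2m, hx2⟩ := hcpt.exists_isMinOn hne hV.continuous.continuousOn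
  have hε : 0 < V x2 := lt_of_le_of_ne (hV0 x2) (Ne.symm (interior_subset (hsupp hx2m)))
  set M := - lap φ x1 + ⟪b x1, gradient φ x1⟫ + (1 / m) * ‖gradient φ x1‖ ^ m
  filter_upwards [eventually_gt_atTop 0, eventually_ge_atTop ((ρ ^ mst / mst + M) / V x2)]
    with β hβ hβ2
  refine ⟨hφc, fun x => ?_⟩
  have hcβ : 0 ≤ c₁ * β ^ (-(1 / (η - 1))) := by positivity
  rcases le_total ‖x‖ R with hx | hx
  · have hxm : x ∈ Metric.closedBall (0 : Euc d) R := by simpa using hx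
    have h1 := hx1 hxm
    have h2 := hx2 hxm
    simp only [Set.mem_ofPred_eq] at h1 h2
    rw [div_le_iff₀ hε] at hβ2
    have h3 := mul_le_mul_of_nonneg_left h2 hβ.le
    linarith
  · have hr : 0 < ‖x‖ := lt_of_lt_of_le hR hx
    obtain ⟨hα, hVx⟩ := hout x hx
    have hbx := hbe x hx
    rw [hφ, testφ_lap d κ R hR x hx, testφ_gradient d κ R hR x hx, hVx, hbx, hα]
    have hng : ‖(-κ / ‖x‖) • x‖ = κ := by
      rw [norm_smul, norm_div, norm_neg, norm_norm, Real.norm_of_nonneg hκ0.le]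
      field_simp
    have hin : ⟪((ρ + a * ‖x‖⁻¹) * ‖x‖ ^ ((0 : ℝ) - 1)) • x, (-κ / ‖x‖) • x⟫
        = - (κ * ρ) - κ * a / ‖x‖ := by
      rw [real_inner_smul_left, real_inner_smul_right, real_inner_self_eq_norm_sq, zero_sub,
        Real.rpow_neg_one]
      field_simp
      ring
    have hκm : κ ^ m = ρ ^ mst := by
      rw [hκ, ← Real.rpow_mul hρ.le]
      congr 1
      rw [hmst]; field_simp; ring
    have hκρ : κ * ρ = ρ ^ mst := by
      rw [hκ, Real.rpow_sub_one hρ.ne']; field_simp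
    have hms : ρ ^ mst / mst = ρ ^ mst - 1 / m * ρ ^ mst := by
      rw [hmst]; field_simp
    have hy := aux_young η _ β ‖x‖ hη1 hA hβ hr
    rw [← hc₁] at hy
    rw [hng, hin, hκm, hκρ, hms]
    have : κ * ((d : ℝ) - 1 - a) / ‖x‖ = κ * ((d : ℝ) - 1) / ‖x‖ - κ * a / ‖x‖ := by ring
    have h4 : -κ * ((d : ℝ) - 1) / ‖x‖ = - (κ * ((d : ℝ) - 1) / ‖x‖) := by ring
    rw [h4]
    linarith

lemma aux_limsup (f : ℝ → ℝ) (c : ℝ) (hc : 0 ≤ c) (h : ∀ᶠ x in atTop, f x ≤ c) :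
    limsup f atTop ≤ c := by
  rw [limsup_eq]
  by_cases hb : BddBelow {a | ∀ᶠ n in atTop, f n ≤ a}
  · exact csInf_le hb h
  · rw [Real.sInf_of_not_bddBelow hb]; exact hc

/-- upper estimate for `ρ^{m*}/m* - λ_max(β)` in the moderate drift case. -/
theorem stmt17 (d : ℕ) (hd : 1 ≤ d) (m ρ R a η : ℝ) (hm : 1 < m)
    (hρ : 0 < ρ) (hη : 0 < η) (hR : 0 < R)
    (mst : ℝ) (hmst : mst = m / (m - 1))
    (b : Euc d → Euc d) (V : Euc d → ℝ) (α : Euc d → ℝ)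
    (hH1 : HypH1 0 ρ R a η b V α)
    (hη1 : 1 < η) (ha : a < (d : ℝ) - 1)
    (c₁ : ℝ) (hc₁ : c₁ = (η - 1) * (ρ ^ (mst - 1) * ((d : ℝ) - 1 - a) / η) ^ (η / (η - 1))) :
    Filter.limsup (fun β : ℝ => β ^ (1 / (η - 1)) * (ρ ^ mst / mst - lamMax m b V β))
      atTop ≤ c₁ := by
  have hη0 : 0 < η - 1 := by linarith
  have hm1 : 0 < m - 1 := by linarith
  have hmst0 : 0 < mst := by rw [hmst]; positivity
  have hc0 : 0 ≤ c₁ := by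
    have : 0 ≤ (d : ℝ) - 1 - a := by linarith
    rw [hc₁]; positivity
  have hV0 := hH1.1.2.2.2.2.2.2.1
  have hsub := aux_subsol d m ρ R a η hm hρ hR mst hmst b V α hH1 hη1 ha c₁ hc₁
  by_cases hbd : ∀ β : ℝ, BddAbove {lam : ℝ | ∃ φ : Euc d → ℝ, IsSubsol m b V β lam φ}
  · refine aux_limsup _ _ hc0 ?_
    filter_upwards [hsub, eventually_gt_atTop 0] with β hβ hβ0
    have h1 : ρ ^ mst / mst - c₁ * β ^ (-(1 / (η - 1))) ≤ lamMax m b V β :=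
      le_csSup (hbd β) ⟨_, hβ⟩
    have hp : 0 < β ^ (1 / (η - 1)) := by positivity
    calc β ^ (1 / (η - 1)) * (ρ ^ mst / mst - lamMax m b V β)
        ≤ β ^ (1 / (η - 1)) * (c₁ * β ^ (-(1 / (η - 1)))) :=
          mul_le_mul_of_nonneg_left (by linarith) hp.le
      _ = c₁ := by
          rw [Real.rpow_neg hβ0.le]; field_simp
  · -- if the set of admissible values is unbounded for one β, it is so for all larger ones
    push Not at hbd
    obtain ⟨β0, hβ0⟩ := hbd
    have hz : ∀ β, β0 ≤ β → lamMax m b V β = 0 := by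
      intro β hβ
      refine Real.sSup_of_not_bddAbove fun h => hβ0 (h.mono ?_)
      rintro lam ⟨φ, hφ, hle⟩
      refine ⟨φ, hφ, fun x => ?_⟩
      have := hle x
      have := mul_le_mul_of_nonneg_right hβ (hV0 x)
      linarith
    have ht : Tendsto (fun β : ℝ => β ^ (1 / (η - 1)) * (ρ ^ mst / mst - lamMax m b V β))
        atTop atTop := by
      have h1 : Tendsto (fun β : ℝ => β ^ (1 / (η - 1)) * (ρ ^ mst / mst)) atTop atTop :=
        (tendsto_rpow_atTop (by positivity)).atTop_mul_const (by positivity)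
      refine h1.congr' ?_
      filter_upwards [eventually_ge_atTop β0] with β hβ
      rw [hz β hβ, sub_zero]
    have hempty : {c : ℝ | ∀ᶠ β : ℝ in atTop,
        β ^ (1 / (η - 1)) * (ρ ^ mst / mst - lamMax m b V β) ≤ c} = ∅ := by
      ext c
      simp only [Set.mem_ofPred_eq, Set.mem_empty_iff_false, iff_false]
      intro h
      obtain ⟨x, hx1, hx2⟩ := (h.and (ht.eventually_gt_atTop c)).exists
      linarith
    rw [limsup_eq, hempty, Real.sInf_empty]
    exact hc0

end
end

section
/- Let d ≥ 1, m > 1, and suppose (b,V) satisfies hypothesis (H1) with parameters δ > 0, ρ > 0, a ∈ ℝ, η > 0, R > 0. Consider the function φ₀ ∈ C³(ℝ^d) with φ₀(x) = −ρ^{m*−1}(1 + δ/(m−1))^{−1}|x|^{1+δ/(m−1)} for all x ∉ B_R, where m* = m/(m−1). Then for every ε > 0 there exist constants r_ε > 0, c_ε > 0 with c_ε → c₀ as ε → 0 (c₀ as in the sharp estimate (3.1)) and β₀ > 0 such that for all β ≥ β₀ the pair (c_ε β^{δm*/(δm*+η)}, φ₀) is a subsolution of (EP); consequently λ_max(β)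 ≥ c_ε β^{δm*/(δm*+η)} for all β ≥ β₀. -/
open Filter Real RealInnerProductSpace

noncomputable section

open Topology

lemma one_dim_max {h h1 : ℝ → ℝ} {h2 : ℝ} (hm : IsLocalMax h 0)
    (hd : ∀ᶠ t in 𝓝 0, HasDerivAt h (h1 t) t) (hd2 : HasDerivAt h1 h2 0) : h2 ≤ 0 := by
  by_contra hc
  push Not at hc
  have e1 : deriv h =ᶠ[𝓝 0] h1 := hd.mono fun t ht => ht.deriv
  have hz : deriv h 0 = 0 := hm.deriv_eq_zero
  have e2 : deriv (deriv h) 0 = h2 := by rw [e1.deriv_eq, hd2.deriv]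
  have hmin : IsLocalMin h 0 := isLocalMin_of_deriv_deriv_pos (by rw [e2]; exact hc) hz
    hd.self_of_nhds.continuousAt
  have e3 : h =ᶠ[𝓝 0] fun _ => h 0 := by
    filter_upwards [hm, hmin] with t a b using le_antisymm a b
  have e4 : deriv h =ᶠ[𝓝 0] fun _ => 0 := by
    refine e3.deriv.trans ?_
    simp
  have e5 : deriv (deriv h) 0 = 0 := by rw [e4.deriv_eq]; simp
  linarith

lemma hasFDerivAt_radial {d : ℕ} {g : ℝ → ℝ} {g' : ℝ} {x : Euc d}
    (h : HasDerivAt g g' (‖x‖ ^ 2)) :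
    HasFDerivAt (fun y : Euc d => g (‖y‖ ^ 2)) ((2 * g') • innerSL ℝ x) x := by
  have h1 : HasFDerivAt (fun y : Euc d => ‖y‖ ^ 2) (2 • innerSL ℝ x) x :=
    (hasStrictFDerivAt_norm_sq x).hasFDerivAt
  have := h.comp_hasFDerivAt x h1
  refine this.congr_fderiv ?_
  ext y
  simp
  ring

lemma hasFDerivAt_coord {d : ℕ} {g : ℝ → ℝ} {g' : ℝ} {x : Euc d} (i : Fin d)
    (h : HasDerivAt g g' (‖x‖ ^ 2)) :
    HasFDerivAt (fun y : Euc d => 2 * g (‖y‖ ^ 2) * y i)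
      ((2 * g (‖x‖ ^ 2)) • (EuclideanSpace.proj i : Euc d →L[ℝ] ℝ) +
        (x i) • (2 : ℝ) • ((2 * g') • innerSL ℝ x)) x := by
  exact ((hasFDerivAt_radial h).const_mul 2).mul (EuclideanSpace.proj (𝕜 := ℝ) i).hasFDerivAt

lemma radial {d : ℕ} {φ : Euc d → ℝ} {g g1 : ℝ → ℝ} {g2 : ℝ} {x : Euc d}
    (h : ∀ᶠ y in 𝓝 x, φ y = g (‖y‖ ^ 2))
    (h1 : ∀ᶠ s in 𝓝 (‖x‖ ^ 2), HasDerivAt g (g1 s) s) (h2 : HasDerivAt g1 g2 (‖x‖ ^ 2)) :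
    gradient φ x = (2 * g1 (‖x‖ ^ 2)) • x ∧
    lap φ x = 4 * g2 * ‖x‖ ^ 2 + 2 * d * g1 (‖x‖ ^ 2) := by
  have hc : Tendsto (fun y : Euc d => ‖y‖ ^ 2) (𝓝 x) (𝓝 (‖x‖ ^ 2)) :=
    (by fun_prop : Continuous (fun y : Euc d => ‖y‖ ^ 2)).tendsto x
  have hF : ∀ᶠ y in 𝓝 x, HasFDerivAt φ ((2 * g1 (‖y‖ ^ 2)) • innerSL ℝ y) y := by
    filter_upwards [h.eventually_nhds, hc.eventually h1] with y hy hy1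
    exact (hasFDerivAt_radial hy1).congr_of_eventuallyEq hy
  constructor
  · refine HasGradientAt.gradient ?_
    rw [hasGradientAt_iff_hasFDerivAt]
    refine hF.self_of_nhds.congr_fderiv ?_
    ext y; simp
  · have : ∀ i : Fin d, fderiv ℝ (fun y => fderiv ℝ φ y (EuclideanSpace.single i 1)) x
        (EuclideanSpace.single i 1) = 4 * g2 * (x i) ^ 2 + 2 * g1 (‖x‖ ^ 2) := by
      intro i
      have e : (fun y => fderiv ℝ φ y (EuclideanSpace.single i 1)) =ᶠ[𝓝 x]
          fun y => 2 * g1 (‖y‖ ^ 2) * y i := by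
        filter_upwards [hF] with y hy
        rw [hy.fderiv]
        simp [EuclideanSpace.inner_single_right]
      rw [e.fderiv_eq, (hasFDerivAt_coord i h2).fderiv]
      simp [EuclideanSpace.inner_single_right]
      ring
    unfold lap
    rw [Finset.sum_congr rfl fun i _ => this i, Finset.sum_add_distrib, ← Finset.mul_sum,
      EuclideanSpace.norm_sq_eq]
    simp
    ring

lemma radial_max {d : ℕ} {φ : Euc d → ℝ} {g g1 : ℝ → ℝ} {g2 : ℝ} {x : Euc d}
    (hφ : ContDiff ℝ 3 φ)
    (hmax : IsLocalMax (fun y => φ y - g (‖y‖ ^ 2)) x)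
    (h1 : ∀ᶠ s in 𝓝 (‖x‖ ^ 2), HasDerivAt g (g1 s) s) (h2 : HasDerivAt g1 g2 (‖x‖ ^ 2)) :
    gradient φ x = (2 * g1 (‖x‖ ^ 2)) • x ∧
    lap φ x ≤ 4 * g2 * ‖x‖ ^ 2 + 2 * d * g1 (‖x‖ ^ 2) := by
  have hc : Tendsto (fun y : Euc d => ‖y‖ ^ 2) (𝓝 x) (𝓝 (‖x‖ ^ 2)) :=
    (by fun_prop : Continuous (fun y : Euc d => ‖y‖ ^ 2)).tendsto x
  have hdφ : Differentiable ℝ φ := hφ.differentiable (by norm_num)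
  have hdφ2 : Differentiable ℝ (fderiv ℝ φ) :=
    (hφ.fderiv_right (m := 2) (by norm_num)).differentiable (by norm_num)
  have hF : ∀ᶠ y in 𝓝 x, HasFDerivAt (fun y => φ y - g (‖y‖ ^ 2))
      (fderiv ℝ φ y - (2 * g1 (‖y‖ ^ 2)) • innerSL ℝ y) y := by
    filter_upwards [hc.eventually h1] with y hy1
    exact (hdφ y).hasFDerivAt.sub (hasFDerivAt_radial hy1)
  constructor
  · have h0 := hmax.hasFDerivAt_eq_zero hF.self_of_nhds
    rw [sub_eq_zero] at h0
    refine HasGradientAt.gradient ?_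
    rw [hasGradientAt_iff_hasFDerivAt]
    refine (hdφ x).hasFDerivAt.congr_fderiv ?_
    rw [h0]
    ext y; simp
  · have : ∀ i : Fin d, fderiv ℝ (fun y => fderiv ℝ φ y (EuclideanSpace.single i 1)) x
        (EuclideanSpace.single i 1) ≤ 4 * g2 * (x i) ^ 2 + 2 * g1 (‖x‖ ^ 2) := by
      intro i
      set e : Euc d := EuclideanSpace.single i 1 with he
      have hl : ∀ t : ℝ, HasDerivAt (fun t : ℝ => x + t • e) e t := by
        intro t
        simpa using ((hasDerivAt_id t).smul_const e).const_add x
      have hl0 : Tendsto (fun t : ℝ => x + t • e) (𝓝 0) (𝓝 x) := by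
        simpa using (hl 0).continuousAt.tendsto
      have x0 : x + (0 : ℝ) • e = x := by simp
      have key := one_dim_max (h := fun t => φ (x + t • e) - g (‖x + t • e‖ ^ 2))
        (h1 := fun t => fderiv ℝ φ (x + t • e) e - 2 * g1 (‖x + t • e‖ ^ 2) * (x + t • e) i)
        (h2 := fderiv ℝ (fun y => fderiv ℝ φ y e) x e - (4 * g2 * (x i) ^ 2 + 2 * g1 (‖x‖ ^ 2)))
        ?_ ?_ ?_
      · linarith
      · have := hl0.eventually hmax
        simpa [IsLocalMax, IsMaxFilter] using this
      · filter_upwards [hl0.eventually hF] with t ht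
        have := ht.comp_hasDerivAt t (hl t)
        refine this.congr_deriv ?_
        simp [he, EuclideanSpace.inner_single_right]
        ring
      · have hA : HasFDerivAt (fun y => fderiv ℝ φ y e) (fderiv ℝ (fun y => fderiv ℝ φ y e) x) x :=
          ((hdφ2 x).clm_apply (differentiableAt_const e)).hasFDerivAt
        have hB := hA.sub (hasFDerivAt_coord i h2)
        rw [← x0] at hB
        have := hB.comp_hasDerivAt (0 : ℝ) (hl 0)
        refine this.congr_deriv ?_
        simp [he, EuclideanSpace.inner_single_right]
        ring
    unfold lap
    refine (Finset.sum_le_sum fun i _ => this i).trans (le_of_eq ?_)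
    rw [Finset.sum_add_distrib, ← Finset.mul_sum,
      EuclideanSpace.norm_sq_eq]
    simp
    ring

lemma barrier_bound {m k C : ℝ} (hm : 1 < m) (hk : k = 1 + 1 / (m - 1)) (hC : 0 ≤ C) :
    ∃ K : ℝ, ∀ n : ℝ, 0 ≤ n → n < 1 →
      C * (1 - n ^ 2) ^ (-k - 2) - (1 / m) * (2 * k * (1 - n ^ 2) ^ (-k - 1) * n) ^ m ≤ K := by
  have hm1 : 0 < m - 1 := by linarith
  have hk0 : 0 < k := by rw [hk]; positivity
  have he : 0 < 2 * (m - 1) := by positivity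
  have hlim : Tendsto (fun t : ℝ => C * t ^ (2 * (m - 1))) (𝓝 0) (𝓝 0) := by
    have : ContinuousAt (fun t : ℝ => C * t ^ (2 * (m - 1))) 0 :=
      continuousAt_const.mul (Real.continuousAt_rpow_const _ _ (Or.inr he.le))
    have h2 := this.tendsto
    simpa [Real.zero_rpow he.ne'] using h2
  have hpos : 0 < k ^ m / m := by positivity
  obtain ⟨t1, ht1, hT⟩ := Metric.eventually_nhds_iff.1 (hlim.eventually (gt_mem_nhds hpos))
  set t0 := min (t1 / 2) (1 / 2) with ht0
  have ht0p : 0 < t0 := by positivity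
  refine ⟨C * t0 ^ (-k - 2), fun n hn0 hn1 => ?_⟩
  set t := 1 - n ^ 2 with ht
  have htp : 0 < t := by nlinarith
  rcases le_total t0 t with h | h
  · have h1 : t ^ (-k - 2) ≤ t0 ^ (-k - 2) :=
      Real.rpow_le_rpow_of_nonpos ht0p h (by linarith)
    have h2 : 0 ≤ (1 / m) * (2 * k * t ^ (-k - 1) * n) ^ m := by positivity
    nlinarith [mul_le_mul_of_nonneg_left h1 hC]
  · have htt1 : t < t1 := by
      have := min_le_left (t1 / 2) (1 / 2); linarith
    have hth : t ≤ 1 / 2 := h.trans (min_le_right _ _)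
    have hn : 1 / 2 ≤ n := by nlinarith
    have h1 : C * t ^ (2 * (m - 1)) < k ^ m / m :=
      hT (by rw [Real.dist_eq, sub_zero, abs_of_pos htp]; exact htt1)
    have h2 : (k * t ^ (-k - 1)) ^ m ≤ (2 * k * t ^ (-k - 1) * n) ^ m := by
      apply Real.rpow_le_rpow (by positivity) _ (by linarith)
      have : 0 < k * t ^ (-k - 1) := by positivity
      nlinarith
    have h3 : (k * t ^ (-k - 1)) ^ m = k ^ m * t ^ ((-k - 1) * m) := by
      rw [Real.mul_rpow hk0.le (by positivity), ← Real.rpow_mul htp.le]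
    have h4 : C * t ^ (-k - 2) = (C * t ^ (2 * (m - 1))) * t ^ ((-k - 1) * m) := by
      rw [mul_assoc, ← Real.rpow_add htp]
      congr 2
      rw [hk]; field_simp; ring
    have h5 : (C * t ^ (2 * (m - 1))) * t ^ ((-k - 1) * m) ≤ k ^ m / m * t ^ ((-k - 1) * m) :=
      mul_le_mul_of_nonneg_right h1.le (by positivity)
    have h6 : C * t ^ (-k - 2) ≤ (1 / m) * (2 * k * t ^ (-k - 1) * n) ^ m := by
      rw [h4]
      refine h5.trans ?_
      have : k ^ m / m * t ^ ((-k - 1) * m) = (1 / m) * (k ^ m * t ^ ((-k - 1) * m)) := by ring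
      rw [this, ← h3]
      exact mul_le_mul_of_nonneg_left h2 (by positivity)
    have : 0 ≤ C * t0 ^ (-k - 2) := by positivity
    linarith

lemma exists_barrier_max {d : ℕ} {k : ℝ} (hk : 1 ≤ k) {φ : Euc d → ℝ} (hφ : Continuous φ) :
    ∃ x : Euc d, ‖x‖ < 1 ∧ IsLocalMax (fun y => φ y - (1 - ‖y‖ ^ 2) ^ (-k)) x := by
  obtain ⟨M, hM⟩ := (isCompact_closedBall (0 : Euc d) 1).exists_bound_of_continuousOn
    hφ.continuousOn
  have hM0 : 0 ≤ M := (norm_nonneg _).trans (hM 0 (by simp))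
  set t : ℝ := 1 / (2 * M + 2) with ht
  have htp : 0 < t := by positivity
  have ht1 : t < 1 := by rw [ht, div_lt_one (by positivity)]; linarith
  set r := √(1 - t) with hr
  have hr2 : r ^ 2 = 1 - t := Real.sq_sqrt (by linarith)
  have hr0 : 0 ≤ r := Real.sqrt_nonneg _
  have hr1 : r < 1 := by nlinarith
  have hbase : ∀ y ∈ Metric.closedBall (0 : Euc d) r, 0 < 1 - ‖y‖ ^ 2 := by
    intro y hy
    rw [mem_closedBall_zero_iff] at hy
    nlinarith [norm_nonneg y]
  obtain ⟨x, hx, hxm⟩ := (isCompact_closedBall (0 : Euc d) r).exists_isMaxOn ⟨0, by simpa⟩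
    (f := fun y => φ y - (1 - ‖y‖ ^ 2) ^ (-k)) (by
      refine hφ.continuousOn.sub ?_
      refine ContinuousOn.rpow_const (by fun_prop) fun y hy => Or.inl (hbase y hy).ne')
  have hxr : ‖x‖ ≤ r := by simpa using hx
  have hlt : ‖x‖ < r := by
    refine lt_of_le_of_ne hxr fun heq => ?_
    have h0 := hxm (show (0 : Euc d) ∈ Metric.closedBall 0 r by simpa)
    simp only [Set.mem_ofPred_eq] at h0
    rw [heq, hr2] at h0
    have e1 : (2 * M + 2) ≤ (1 - (1 - t)) ^ (-k) := by
      have : t ^ (-1 : ℝ) ≤ t ^ (-k) :=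
        Real.rpow_le_rpow_of_exponent_ge htp ht1.le (by linarith)
      rw [sub_sub_cancel]
      refine le_trans (le_of_eq ?_) this
      rw [Real.rpow_neg_one, ht]; simp
    have e2 : φ x ≤ M := (le_abs_self _).trans (hM x (by simp; linarith))
    have e3 : -M ≤ φ 0 := (abs_le.1 (hM 0 (by simp))).1
    have e4 : ((1 : ℝ) - ‖(0 : Euc d)‖ ^ 2) ^ (-k) = 1 := by simp
    rw [e4] at h0
    linarith
  refine ⟨x, by linarith, hxm.isLocalMax ?_⟩
  exact Filter.mem_of_superset (Metric.isOpen_ball.mem_nhds (by simpa using hlt))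
    Metric.ball_subset_closedBall

lemma bdd_subsol {d : ℕ} {m : ℝ} (hm : 1 < m) {b : Euc d → Euc d} {V : Euc d → ℝ}
    (hb : Continuous b) (hV : Continuous V) (β : ℝ) :
    BddAbove {lam : ℝ | ∃ φ : Euc d → ℝ, IsSubsol m b V β lam φ} := by
  obtain ⟨k, hk⟩ : ∃ k : ℝ, k = 1 + 1 / (m - 1) := ⟨_, rfl⟩
  have hm1 : 0 < m - 1 := by linarith
  have hk1 : 1 ≤ k := by
    have : 0 < 1 / (m - 1) := by positivity
    linarith
  obtain ⟨B, hB⟩ := (isCompact_closedBall (0 : Euc d) 1).exists_bound_of_continuousOn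
    hb.continuousOn
  have hB0 : 0 ≤ B := (norm_nonneg _).trans (hB 0 (by simp))
  obtain ⟨W, hW⟩ := (isCompact_closedBall (0 : Euc d) 1).exists_bound_of_continuousOn
    (hV.const_mul β).continuousOn
  obtain ⟨K, hK⟩ := barrier_bound (C := 4 * (k * (k + 1)) + 2 * d * k + B * (2 * k)) hm hk
    (by positivity)
  refine ⟨K + W, ?_⟩
  rintro lam ⟨φ, hφ, hsub⟩
  obtain ⟨x, hx1, hmax⟩ := exists_barrier_max hk1 hφ.continuous
  have hn := norm_nonneg x
  have htp : 0 < 1 - ‖x‖ ^ 2 := by nlinarith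
  have ht1 : 1 - ‖x‖ ^ 2 ≤ 1 := by nlinarith
  have hd : ∀ (c p s : ℝ), 0 < 1 - s →
      HasDerivAt (fun s : ℝ => c * (1 - s) ^ p) (c * (-p) * (1 - s) ^ (p - 1)) s := by
    intro c p s hs
    have h := (((hasDerivAt_id s).const_sub 1).rpow_const (p := p) (Or.inl hs.ne')).const_mul c
    refine h.congr_deriv ?_
    simp; ring
  obtain ⟨hg, hl⟩ := radial_max (g := fun s => (1 - s) ^ (-k))
    (g1 := fun s => k * (1 - s) ^ (-k - 1))
    (g2 := k * (k + 1) * (1 - ‖x‖ ^ 2) ^ (-k - 2)) hφ hmax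
    (by
      have : ∀ᶠ s in 𝓝 (‖x‖ ^ 2), s < 1 := gt_mem_nhds (by linarith)
      filter_upwards [this] with s hs
      simpa using hd 1 (-k) s (by linarith))
    (by
      refine (hd k (-k - 1) _ htp).congr_deriv ?_
      rw [show -k - 1 - 1 = -k - 2 by ring]; ring)
  have hs := hsub x
  have hKx := hK ‖x‖ hn hx1
  set t := 1 - ‖x‖ ^ 2 with ht
  have hy : 0 < t ^ (-k - 1) := by positivity
  have hz : 0 < t ^ (-k - 2) := by positivity
  have hyz : t ^ (-k - 1) ≤ t ^ (-k - 2) :=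
    Real.rpow_le_rpow_of_exponent_ge htp ht1 (by linarith)
  have hgn : ‖gradient φ x‖ = 2 * k * t ^ (-k - 1) * ‖x‖ := by
    rw [hg, norm_smul, Real.norm_of_nonneg (by positivity)]; ring
  have hxb : x ∈ Metric.closedBall (0 : Euc d) 1 := by simpa using hx1.le
  have hin : -(B * (2 * k) * t ^ (-k - 2)) ≤ ⟪b x, gradient φ x⟫ := by
    have h1 := (abs_le.1 (abs_real_inner_le_norm (b x) (gradient φ x))).1
    have h2 : ‖b x‖ * ‖gradient φ x‖ ≤ B * (2 * k * t ^ (-k - 2)) := by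
      apply mul_le_mul (hB x hxb) _ (norm_nonneg _) hB0
      rw [hgn]
      calc 2 * k * t ^ (-k - 1) * ‖x‖ ≤ 2 * k * t ^ (-k - 1) * 1 := by gcongr
        _ ≤ 2 * k * t ^ (-k - 2) := by rw [mul_one]; gcongr
    linarith
  have hWx : β * V x ≤ W := (le_abs_self _).trans (hW x hxb)
  have h4 : 4 * (k * (k + 1) * t ^ (-k - 2)) * ‖x‖ ^ 2 ≤ 4 * (k * (k + 1)) * t ^ (-k - 2) := by
    have : 0 < 4 * (k * (k + 1)) * t ^ (-k - 2) := by positivity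
    nlinarith
  have h5 : 2 * d * (k * t ^ (-k - 1)) ≤ 2 * d * k * t ^ (-k - 2) := by
    have : 2 * (d : ℝ) * (k * t ^ (-k - 1)) = 2 * d * k * t ^ (-k - 1) := by ring
    rw [this]
    gcongr
  rw [hgn] at hs
  linarith

lemma young_bound {p η A β r : ℝ} (hp : 0 < p) (hη : 0 < η) (hA : 0 < A) (hβ : 0 < β)
    (hr : 0 < r) :
    ((p + η) / p) * (A * p / η) ^ (η / (p + η)) * β ^ (p / (p + η)) ≤
      A * r ^ p + β * r ^ (-η) := by
  have h := Real.geom_mean_le_arith_mean2_weighted (w₁ := η / (p + η)) (w₂ := p / (p + η))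
    (p₁ := A * p / η * r ^ p) (p₂ := β * r ^ (-η)) (by positivity) (by positivity)
    (by positivity) (by positivity) (by field_simp; ring)
  rw [Real.mul_rpow (by positivity) (by positivity), Real.mul_rpow (by positivity) (by positivity),
    ← Real.rpow_mul hr.le, ← Real.rpow_mul hr.le] at h
  have e : r ^ (p * (η / (p + η))) * r ^ (-η * (p / (p + η))) = 1 := by
    rw [← Real.rpow_add hr, show p * (η / (p + η)) + -η * (p / (p + η)) = 0 by ring, Real.rpow_zero]
  have h2 := mul_le_mul_of_nonneg_left h (show 0 ≤ (p + η) / p by positivity)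
  calc _ = (p + η) / p * ((A * p / η) ^ (η / (p + η)) * r ^ (p * (η / (p + η))) *
        (β ^ (p / (p + η)) * r ^ (-η * (p / (p + η))))) := by
        linear_combination (-(((p + η) / p) * (A * p / η) ^ (η / (p + η)) * β ^ (p / (p + η)))) * e
    _ ≤ _ := h2
    _ = _ := by field_simp

lemma phi_ext {d : ℕ} {κ q R : ℝ} (hκ : 0 < κ) (hR : 0 < R) {φ : Euc d → ℝ}
    (hφ : ∀ x : Euc d, R ≤ ‖x‖ → φ x = -(q * (1 + κ)⁻¹ * ‖x‖ ^ (1 + κ))) {x : Euc d}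
    (hx : R < ‖x‖) :
    gradient φ x = (-(q * ‖x‖ ^ (κ - 1))) • x ∧
    lap φ x = -(q * (κ - 1 + d) * ‖x‖ ^ (κ - 1)) := by
  have hx0 : 0 < ‖x‖ := hR.trans hx
  have hpow : ∀ (y : ℝ) (s : ℝ), 0 ≤ y → (y ^ 2) ^ s = y ^ (2 * s) := by
    intro y s hy
    rw [← Real.rpow_natCast y 2, ← Real.rpow_mul hy]; norm_num
  have hd : ∀ (c p s : ℝ), 0 < s →
      HasDerivAt (fun s : ℝ => c * s ^ p) (c * p * s ^ (p - 1)) s := by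
    intro c p s hs
    have h := (Real.hasDerivAt_rpow_const (p := p) (Or.inl hs.ne')).const_mul c
    exact h.congr_deriv (by ring)
  obtain ⟨h1, h2⟩ := radial (φ := φ) (x := x)
    (g := fun s => -(q * (1 + κ)⁻¹) * s ^ ((1 + κ) / 2))
    (g1 := fun s => -(q / 2) * s ^ ((κ - 1) / 2))
    (g2 := -(q / 2) * ((κ - 1) / 2) * (‖x‖ ^ 2) ^ ((κ - 1) / 2 - 1))
    (by
      have : ∀ᶠ y : Euc d in 𝓝 x, R < ‖y‖ :=
        continuous_norm.continuousAt.eventually (lt_mem_nhds hx)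
      filter_upwards [this] with y hy
      rw [hφ y hy.le, hpow _ _ (norm_nonneg _), mul_div_cancel₀ _ (two_ne_zero)]; ring)
    (by
      filter_upwards [lt_mem_nhds (show 0 < ‖x‖ ^ 2 by positivity)] with s hs
      refine (hd _ _ s hs).congr_deriv ?_
      rw [show (1 + κ) / 2 - 1 = (κ - 1) / 2 by ring]
      field_simp)
    (hd _ _ _ (by positivity))
  have e1 : (‖x‖ ^ 2) ^ ((κ - 1) / 2) = ‖x‖ ^ (κ - 1) := by
    rw [hpow _ _ hx0.le, mul_div_cancel₀ _ two_ne_zero]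
  have e2 : (‖x‖ ^ 2) ^ ((κ - 1) / 2 - 1) * ‖x‖ ^ 2 = ‖x‖ ^ (κ - 1) := by
    rw [← e1, ← Real.rpow_add_one (by positivity), sub_add_cancel]
  rw [e1] at h1 h2
  refine ⟨by rw [h1]; congr 1; ring, ?_⟩
  rw [h2]
  linear_combination (-q * (κ - 1)) * e2

lemma ham_ext {d : ℕ} {m δ ρ R a η mst κ : ℝ} (hm : 1 < m) (hδ : 0 < δ) (hρ : 0 < ρ)
    (hR : 0 < R) (hmst : mst = m / (m - 1)) (hκ : κ = δ / (m - 1))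
    {b : Euc d → Euc d} {V α : Euc d → ℝ} (hH1 : HypH1 δ ρ R a η b V α)
    {φ : Euc d → ℝ}
    (hφ : ∀ x : Euc d, R ≤ ‖x‖ → φ x = -(ρ ^ (mst - 1) * (1 + κ)⁻¹ * ‖x‖ ^ (1 + κ))) {x : Euc d}
    (hx : R < ‖x‖) :
    - lap φ x + ⟪b x, gradient φ x⟫ + (1 / m) * ‖gradient φ x‖ ^ m =
      -(‖x‖ ^ (δ * mst) * (ρ ^ mst / mst + ρ ^ (mst - 1) * a * ‖x‖⁻¹
        - ρ ^ (mst - 1) * (κ - 1 + d) * ‖x‖ ^ (-(1 + δ)))) := by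
  have hm1 : 0 < m - 1 := by linarith
  have hm1' : m - 1 ≠ 0 := hm1.ne'
  have hm0 : m ≠ 0 := by linarith
  have hκ0 : 0 < κ := by rw [hκ]; positivity
  have hx0 : 0 < ‖x‖ := hR.trans hx
  obtain ⟨h1, h2⟩ := phi_ext hκ0 hR hφ hx
  have hb := hH1.1.2.2.2.2.1 x hx.le
  have hα := (hH1.2 x hx.le).1
  rw [h2, h1, hb, hα, norm_smul, inner_smul_left, inner_smul_right, real_inner_self_eq_norm_sq,
    norm_neg, Real.norm_of_nonneg (by positivity)]
  have hr1 : ‖x‖ ^ (κ - 1) = ‖x‖ ^ (δ * mst) * ‖x‖ ^ (-(1 + δ)) := by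
    rw [← Real.rpow_add hx0]; congr 1; rw [hκ, hmst]; field_simp; ring
  have hr2 : ‖x‖ ^ (δ - 1) * ‖x‖ ^ (κ - 1) * ‖x‖ ^ 2 = ‖x‖ ^ (δ * mst) := by
    rw [← Real.rpow_natCast, ← Real.rpow_add hx0, ← Real.rpow_add hx0]; congr 1
    rw [hκ, hmst]; push_cast; field_simp; ring
  have hr3 : (ρ ^ (mst - 1) * ‖x‖ ^ (κ - 1) * ‖x‖) ^ m = ρ ^ mst * ‖x‖ ^ (δ * mst) := by
    rw [mul_assoc, ← Real.rpow_add_one hx0.ne', Real.mul_rpow (by positivity) (by positivity),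
      ← Real.rpow_mul hρ.le, ← Real.rpow_mul hx0.le]
    congr 2
    · rw [hmst]; field_simp; ring
    · rw [hκ, hmst]; field_simp; ring
  have hr4 : ρ ^ mst = ρ ^ (mst - 1) * ρ := by
    rw [← Real.rpow_add_one hρ.ne', sub_add_cancel]
  have hr5 : 1 / mst = 1 - 1 / m := by rw [hmst]; field_simp
  rw [hr3, div_eq_mul_one_div (ρ ^ mst) mst, hr5]
  simp only [conj_trivial]
  rw [hr4]
  linear_combination (ρ ^ (mst - 1) * (κ - 1 + d)) * hr1
    - ((ρ + a * ‖x‖⁻¹) * ρ ^ (mst - 1)) * hr2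

lemma lap_continuous {d : ℕ} {φ : Euc d → ℝ} (hφ : ContDiff ℝ 3 φ) : Continuous (lap φ) := by
  unfold lap
  refine continuous_finset_sum _ fun i _ => ?_
  have h1 : ContDiff ℝ 2 (fderiv ℝ φ) := hφ.fderiv_right (by norm_num)
  have h2 : ContDiff ℝ 2 (fun y => fderiv ℝ φ y (EuclideanSpace.single i 1)) :=
    h1.clm_apply contDiff_const
  exact (h2.continuous_fderiv (by norm_num)).clm_apply continuous_const

lemma gradient_continuous {d : ℕ} {φ : Euc d → ℝ} (hφ : ContDiff ℝ 3 φ) :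
    Continuous (gradient φ) := by
  unfold gradient
  exact (InnerProductSpace.toDual ℝ (Euc d)).symm.continuous.comp
    (hφ.continuous_fderiv (by norm_num))

/-- the explicit subsolution construction in the strong drift case:
for every `ε > 0` there are `r_ε > 0` and `c_ε > 0`, with `c_ε → c₀` as `ε → 0⁺`, such that
`(c_ε β^{δm*/(δm*+η)}, φ₀)` is a subsolution of (EP) for all large `β`; consequently
`λ_max(β) ≥ c_ε β^{δm*/(δm*+η)}` for all large `β`. -/
theorem stmt19 (d : ℕ) (hd : 1 ≤ d) (m δ ρ R a η : ℝ) (hm : 1 < m)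
    (hδ : 0 < δ) (hρ : 0 < ρ) (hη : 0 < η) (hR : 0 < R)
    (mst : ℝ) (hmst : mst = m / (m - 1))
    (c₀ : ℝ) (hc₀ : c₀ = ((δ * mst + η) / (δ * mst)) * (ρ ^ mst * δ / η) ^ (η / (δ * mst + η)))
    (b : Euc d → Euc d) (V : Euc d → ℝ) (α : Euc d → ℝ)
    (hH1 : HypH1 δ ρ R a η b V α)
    (φ₀ : Euc d → ℝ) (hφ₀smooth : ContDiff ℝ 3 φ₀)
    (hφ₀ : ∀ x : Euc d, R ≤ ‖x‖ →
      φ₀ x = -(ρ ^ (mst - 1) * (1 + δ / (m - 1))⁻¹ * ‖x‖ ^ (1 + δ / (m - 1)))) :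
    ∃ rε cε : ℝ → ℝ, (∀ ε : ℝ, 0 < ε → 0 < rε ε ∧ 0 < cε ε) ∧
      Tendsto cε (nhdsWithin 0 (Set.Ioi 0)) (nhds c₀) ∧
      ∀ ε : ℝ, 0 < ε → ∃ β₀ : ℝ, 0 < β₀ ∧ ∀ β : ℝ, β₀ ≤ β →
        IsSubsol m b V β (cε ε * β ^ (δ * mst / (δ * mst + η))) φ₀ ∧
        cε ε * β ^ (δ * mst / (δ * mst + η)) ≤ lamMax m b V β := by
  have hm1 : 0 < m - 1 := by linarith
  have hmst0 : 0 < mst := by rw [hmst]; positivity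
  obtain ⟨p, hp⟩ : ∃ p, p = δ * mst := ⟨_, rfl⟩
  have hp0 : 0 < p := by rw [hp]; positivity
  rw [← hp] at hc₀ ⊢
  set A : ℝ → ℝ := fun ε => ρ ^ mst / mst * (1 + ε)⁻¹ with hA
  have hApos : ∀ ε, 0 < ε → 0 < A ε := fun ε hε => by simp only [hA]; positivity
  set c : ℝ → ℝ := fun ε => ((p + η) / p) * (A ε * p / η) ^ (η / (p + η)) with hc
  have hcpos : ∀ ε, 0 < ε → 0 < c ε := fun ε hε => by
    have := hApos ε hε
    simp only [hc]; positivity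
  refine ⟨fun _ => 1, c, fun ε hε => ⟨one_pos, hcpos ε hε⟩, ?_, ?_⟩
  · have hc0 : c 0 = c₀ := by
      simp only [hc, hA, hc₀]
      congr 3
      rw [hp]; field_simp; simp
    rw [← hc0]
    refine Tendsto.mono_left ?_ nhdsWithin_le_nhds
    have h1 : ContinuousAt A 0 := by
      refine continuousAt_const.mul (ContinuousAt.inv₀ (by fun_prop) (by norm_num))
    have : ContinuousAt c 0 := by
      refine continuousAt_const.mul (ContinuousAt.rpow_const ?_ (Or.inr (by positivity)))
      exact (h1.mul_const p).div_const η
    exact this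
  · intro ε hε
    -- exterior radius
    have hbr : Tendsto (fun r : ℝ => ρ ^ mst / mst + ρ ^ (mst - 1) * a * r⁻¹
        - ρ ^ (mst - 1) * (δ / (m - 1) - 1 + d) * r ^ (-(1 + δ))) atTop (𝓝 (ρ ^ mst / mst)) := by
      have t1 : Tendsto (fun r : ℝ => r⁻¹) atTop (𝓝 0) := tendsto_inv_atTop_zero
      have t2 : Tendsto (fun r : ℝ => r ^ (-(1 + δ))) atTop (𝓝 0) :=
        tendsto_rpow_neg_atTop (by linarith)
      simpa using ((t1.const_mul (ρ ^ (mst - 1) * a)).const_add (ρ ^ mst / mst)).sub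
        (t2.const_mul (ρ ^ (mst - 1) * (δ / (m - 1) - 1 + d)))
    have hAlt : A ε < ρ ^ mst / mst := by
      have h0 : 0 < ρ ^ mst / mst := by positivity
      have h1 : (1 + ε)⁻¹ < 1 := inv_lt_one_of_one_lt₀ (by linarith)
      simp only [hA]; nlinarith
    obtain ⟨R1, hR1⟩ := eventually_atTop.1 (hbr.eventually (lt_mem_nhds hAlt))
    set S := max R1 (R + 1) with hS
    have hSR : R < S := by
      have := le_max_right R1 (R + 1); linarith
    -- interior bounds
    have hbc : Continuous b := hH1.1.1.continuous
    have hVc : Continuous V := hH1.1.2.1.continuous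
    have hVpos : ∀ x, 0 < V x := by
      intro x
      rcases le_total R ‖x‖ with h | h
      · rw [(hH1.2 x h).2]
        have : 0 < ‖x‖ := by linarith
        positivity
      · have h1 := interior_subset (hH1.1.2.2.2.2.2.2.2.1 (show x ∈ Metric.closedBall 0 R by simpa))
        exact lt_of_le_of_ne (hH1.1.2.2.2.2.2.2.1 x) (Ne.symm h1)
    have hKc : Continuous (fun x => - lap φ₀ x + ⟪b x, gradient φ₀ x⟫
        + (1 / m) * ‖gradient φ₀ x‖ ^ m) := by
      have g := gradient_continuous hφ₀smooth
      refine ((lap_continuous hφ₀smooth).neg.add (hbc.inner g)).add (continuous_const.mul ?_)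
      exact g.norm.rpow_const fun x => Or.inr (by linarith)
    obtain ⟨M, hM⟩ := (isCompact_closedBall (0 : Euc d) S).exists_bound_of_continuousOn
      hKc.continuousOn
    obtain ⟨x1, -, hx1⟩ := (isCompact_closedBall (0 : Euc d) S).exists_isMinOn
      ⟨0, by simp; linarith⟩ hVc.continuousOn
    have hv := hVpos x1
    have hθ : p / (p + η) < 1 := by rw [div_lt_one (by positivity)]; linarith
    have hlim : Tendsto (fun β : ℝ => c ε * β ^ (-(1 - p / (p + η))) + M * β⁻¹) atTop (𝓝 0) := by
      simpa using ((tendsto_rpow_neg_atTop (y := 1 - p / (p + η)) (by linarith)).const_mul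
        (c ε)).add (tendsto_inv_atTop_zero.const_mul M)
    obtain ⟨β1, hβ1⟩ := eventually_atTop.1 (hlim.eventually (gt_mem_nhds hv))
    refine ⟨max β1 1, by positivity, fun β hβ => ?_⟩
    have hβ0 : 0 < β := lt_of_lt_of_le one_pos ((le_max_right _ _).trans hβ)
    have hmain : IsSubsol m b V β (c ε * β ^ (p / (p + η))) φ₀ := by
      refine ⟨hφ₀smooth, fun x => ?_⟩
      rcases le_or_gt ‖x‖ S with h | h
      · have hxb : x ∈ Metric.closedBall (0 : Euc d) S := by simpa
        have k1 := (le_abs_self _).trans (hM x hxb)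
        have k2 : V x1 ≤ V x := hx1 hxb
        have k3 := hβ1 β ((le_max_left _ _).trans hβ)
        have k4 : β ^ (p / (p + η)) = β * β ^ (-(1 - p / (p + η))) := by
          rw [mul_comm, ← Real.rpow_add_one hβ0.ne']; congr 1; ring
        have k5 : β * (c ε * β ^ (-(1 - p / (p + η))) + M * β⁻¹) ≤ β * V x :=
          mul_le_mul_of_nonneg_left (k3.le.trans k2) hβ0.le
        have k6 : β * (c ε * β ^ (-(1 - p / (p + η))) + M * β⁻¹) =
            c ε * β ^ (p / (p + η)) + M := by
          rw [k4]; field_simp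
        linarith
      · have hx : R < ‖x‖ := hSR.trans h
        have hx0 : 0 < ‖x‖ := hR.trans hx
        have k1 := ham_ext hm hδ hρ hR hmst rfl hH1 hφ₀ hx
        have k2 := hR1 ‖x‖ ((le_max_left _ _).trans h.le)
        have k3 := young_bound hp0 hη (hApos ε hε) hβ0 hx0
        have k4 := mul_le_mul_of_nonneg_left k2.le (show 0 ≤ ‖x‖ ^ p by positivity)
        rw [← hp] at k1
        rw [(hH1.2 x hx.le).2]
        simp only [hc]
        linarith
    exact ⟨hmain, le_csSup (bdd_subsol hm hbc hVc β) ⟨φ₀, hmain⟩⟩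

end
end
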